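/- arXiv:2202.08932 — 6 statements merged into one kernel-verified Lean document; each statement's English description precedes it below -/
import Mathlib

section
/- Let f be an irreducible ternary quadratic form over ℂ and let a be a nonzero linear form. Then exactly one of the following holds: (i) f = a·c + b² for some linear forms b, c such that {a,b,c} is linearly independent; (ii) f = a₀·a² + b·c for some nonzero a₀ ∈ ℂ and some linear forms b, c such that {a,b,c} is linearly independent. -/
open MvPolynomial

/-- Ternary forms: polynomials in three variables over `ℂ`. -/
abbrev Ternary : Type := MvPolynomial (Fin 3) ℂ

/-- A linear form is a homogeneous polynomial of degree 1. -/
def IsLinearForm (a : Ternary) : Prop := MvPolynomial.IsHomogeneous a 1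

/-- The Waring rank of a form `f` (with respect to degree `d`): the least `r`
such that `f` is a sum of `r` `d`-th powers of linear forms. -/
noncomputable def waringRank (d : ℕ) (f : Ternary) : ℕ :=
  sInf {r : ℕ | ∃ l : Fin r → Ternary, (∀ i, IsLinearForm (l i)) ∧ f = ∑ i, (l i) ^ d}

/-- The Hessian determinant of a ternary form: the determinant of the matrix of
second partial derivatives. -/
noncomputable def hess (f : Ternary) : Ternary :=
  Matrix.det (Matrix.of fun i j : Fin 3 =>
    MvPolynomial.pderiv i (MvPolynomial.pderiv j f))

/-- `[abc]`: the determinant of the 3×3 matrix whose rows are the coefficients of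
the linear forms `a`, `b`, `c`. -/
noncomputable def bracket (a b c : Ternary) : ℂ :=
  Matrix.det (Matrix.of
    ![![MvPolynomial.coeff (Finsupp.single 0 1) a, MvPolynomial.coeff (Finsupp.single 1 1) a,
        MvPolynomial.coeff (Finsupp.single 2 1) a],
      ![MvPolynomial.coeff (Finsupp.single 0 1) b, MvPolynomial.coeff (Finsupp.single 1 1) b,
        MvPolynomial.coeff (Finsupp.single 2 1) b],
      ![MvPolynomial.coeff (Finsupp.single 0 1) c, MvPolynomial.coeff (Finsupp.single 1 1) c,
        MvPolynomial.coeff (Finsupp.single 2 1) c]])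

open Submodule in
/-- Three linearly independent linear forms span all linear forms. -/
lemma IsLinearForm.exists_eq_of_linearIndependent {a b c d : Ternary}
    (ha : IsLinearForm a) (hb : IsLinearForm b) (hc : IsLinearForm c)
    (hd : IsLinearForm d) (h : LinearIndependent ℂ ![a, b, c]) :
    ∃ p q r : ℂ, d = C p * a + C q * b + C r * c := by
  have hfin : FiniteDimensional ℂ (homogeneousSubmodule (Fin 3) ℂ 1) := by
    rw [homogeneousSubmodule_one_eq_span_X]
    exact FiniteDimensional.span_of_finite ℂ (Set.finite_range _)
  have hle : span ℂ (Set.range ![a, b, c]) ≤ homogeneousSubmodule (Fin 3) ℂ 1 := by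
    rw [span_le]
    rintro _ ⟨i, rfl⟩
    fin_cases i
    exacts [ha, hb, hc]
  have heq := eq_of_le_of_finrank_le hle (by
    rw [finrank_span_eq_card h, homogeneousSubmodule_one_eq_span_X]
    exact finrank_range_le_card _)
  have hd' : d ∈ span ℂ (Set.range ![a, b, c]) := heq ▸ hd
  obtain ⟨w, rfl⟩ := (mem_span_range_iff_exists_fun ℂ).1 hd'
  exact ⟨w 0, w 1, w 2, by simp [Fin.sum_univ_three, smul_eq_C_mul]⟩

lemma IsLinearForm.add {a b : Ternary} (ha : IsLinearForm a) (hb : IsLinearForm b) :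
    IsLinearForm (a + b) := IsHomogeneous.add ha hb

lemma IsLinearForm.C_mul {a : Ternary} (ha : IsLinearForm a) (p : ℂ) :
    IsLinearForm (C p * a) := IsHomogeneous.C_mul ha p

/-- A linear form is a linear combination of the variables. -/
lemma IsLinearForm.exists_eq_X {a : Ternary} (ha : IsLinearForm a) :
    ∃ w : Fin 3 → ℂ, a = ∑ i, C (w i) * X i := by
  have h : a ∈ homogeneousSubmodule (Fin 3) ℂ 1 := ha
  rw [homogeneousSubmodule_one_eq_span_X] at h
  obtain ⟨w, rfl⟩ := (Submodule.mem_span_range_iff_exists_fun ℂ).1 h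
  exact ⟨w, by simp [smul_eq_C_mul]⟩

/-- A nonzero linear form can be completed to a spanning triple of linear forms. -/
lemma IsLinearForm.exists_spanning_triple {a : Ternary} (ha : IsLinearForm a) (h0 : a ≠ 0) :
    ∃ y z : Ternary, IsLinearForm y ∧ IsLinearForm z ∧
      ∀ d, IsLinearForm d → ∃ p q r : ℂ, d = C p * a + C q * y + C r * z := by
  obtain ⟨w, rfl⟩ := ha.exists_eq_X
  obtain ⟨i, hi⟩ : ∃ i, w i ≠ 0 := by
    by_contra! h
    simp [h] at h0
  have hX (j : Fin 3) : IsLinearForm (X j) := isHomogeneous_X ℂ j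
  refine ⟨X (i + 1), X (i + 2), hX _, hX _, fun d hd => ?_⟩
  obtain ⟨v, rfl⟩ := hd.exists_eq_X
  refine ⟨v i / w i, v (i + 1) - v i / w i * w (i + 1), v (i + 2) - v i / w i * w (i + 2), ?_⟩
  have hsum (u : Fin 3 → ℂ) : ∑ j, C (u j) * (X j : Ternary) =
      C (u i) * X i + C (u (i + 1)) * X (i + 1) + C (u (i + 2)) * X (i + 2) := by
    fin_cases i <;> simp [Fin.sum_univ_three] <;> ring
  have hC : (C (v i) : Ternary) = C (v i / w i) * C (w i) := by
    rw [← map_mul, div_mul_cancel₀ _ hi]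
  rw [hsum, hsum, hC]
  simp only [map_sub, map_mul]
  ring

/-- A quadratic form is a quadratic polynomial in any spanning triple of linear forms. -/
lemma exists_eq_quadratic_of_spanning {f a y z : Ternary} (hf : IsHomogeneous f 2)
    (hs : ∀ d, IsLinearForm d → ∃ p q r : ℂ, d = C p * a + C q * y + C r * z) :
    ∃ p q r s t u : ℂ, f = C p * a ^ 2 + C q * (a * y) + C r * (a * z) +
      (C s * y ^ 2 + C t * (y * z) + C u * z ^ 2) := by
  have h : f ∈ homogeneousSubmodule (Fin 3) ℂ 1 * homogeneousSubmodule (Fin 3) ℂ 1 := by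
    rw [← pow_two, homogeneousSubmodule_one_pow]
    exact hf
  induction h using Submodule.mul_induction_on' with
  | mem_mul_mem m hm n hn =>
    obtain ⟨p, q, r, rfl⟩ := hs m hm
    obtain ⟨p', q', r', rfl⟩ := hs n hn
    refine ⟨p * p', p * q' + q * p', p * r' + r * p', q * q', q * r' + r * q', r * r', ?_⟩
    simp only [C_add, C_mul]
    ring
  | add m hm n hn ihm ihn =>
    have hV (g : Ternary)
        (hg : g ∈ homogeneousSubmodule (Fin 3) ℂ 1 * homogeneousSubmodule (Fin 3) ℂ 1) :
        IsHomogeneous g 2 := by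
      rwa [← pow_two, homogeneousSubmodule_one_pow] at hg
    obtain ⟨p, q, r, s, t, u, rfl⟩ := ihm (hV _ hm)
    obtain ⟨p', q', r', s', t', u', rfl⟩ := ihn (hV _ hn)
    refine ⟨p + p', q + q', r + r', s + s', t + t', u + u', ?_⟩
    simp only [C_add]
    ring

/-- Over `ℂ` a binary quadratic form splits into linear factors. -/
lemma Complex.exists_binary_quadratic_factors (α β γ : ℂ) :
    ∃ s t u v : ℂ, α = s * u ∧ β = s * v + t * u ∧ γ = t * v := by
  by_cases hα : α = 0
  · exact ⟨0, 1, β, γ, by simp [hα], by simp, by simp⟩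
  · obtain ⟨δ, hδ⟩ := IsAlgClosed.exists_pow_nat_eq (β ^ 2 - 4 * α * γ) two_pos
    refine ⟨α, (β + δ) / 2, 1, (β - δ) / (2 * α), by ring, by field_simp; ring, ?_⟩
    field_simp
    linear_combination hδ

/-- Over `ℂ` a binary quadratic form with vanishing discriminant is a square. -/
lemma Complex.exists_sq_of_discrim_eq_zero {α β γ : ℂ} (h : β ^ 2 - 4 * α * γ = 0) :
    ∃ m n : ℂ, α = m ^ 2 ∧ β = 2 * m * n ∧ γ = n ^ 2 := by
  obtain ⟨m, rfl⟩ := IsAlgClosed.exists_pow_nat_eq α two_pos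
  obtain ⟨n, rfl⟩ := IsAlgClosed.exists_pow_nat_eq γ two_pos
  have hβ : (β - 2 * m * n) * (β + 2 * m * n) = 0 := by linear_combination h
  rcases mul_eq_zero.1 hβ with hβ | hβ
  · exact ⟨m, n, rfl, by linear_combination hβ, rfl⟩
  · exact ⟨m, -n, rfl, by linear_combination hβ, by ring⟩

/-- A quadratic polynomial in two linear forms is a product of linear forms. -/
lemma exists_factors_of_two_linear_forms {x y : Ternary} (hx : IsLinearForm x)
    (hy : IsLinearForm y) (α β γ : ℂ) :
    ∃ b c : Ternary, IsLinearForm b ∧ IsLinearForm c ∧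
      C α * x ^ 2 + C β * (x * y) + C γ * y ^ 2 = b * c := by
  obtain ⟨s, t, u, v, rfl, rfl, rfl⟩ := Complex.exists_binary_quadratic_factors α β γ
  refine ⟨C s * x + C t * y, C u * x + C v * y, (hx.C_mul _).add (hy.C_mul _),
    (hx.C_mul _).add (hy.C_mul _), ?_⟩
  simp only [C_add, C_mul]
  ring

/-- A quadratic polynomial in three linearly dependent linear forms is a product of
linear forms. -/
lemma exists_factors_of_not_linearIndependent {a b c : Ternary} (ha : IsLinearForm a)
    (hb : IsLinearForm b) (hc : IsLinearForm c) (h : ¬ LinearIndependent ℂ ![a, b, c])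
    (p q r s t u : ℂ) :
    ∃ x y : Ternary, IsLinearForm x ∧ IsLinearForm y ∧
      C p * a ^ 2 + C q * (a * b) + C r * (a * c) +
      (C s * b ^ 2 + C t * (b * c) + C u * c ^ 2) = x * y := by
  obtain ⟨w, hw, i, hi⟩ := Fintype.not_linearIndependent_iff.1 h
  replace hw : C (w 0) * a + C (w 1) * b + C (w 2) * c = 0 := by
    simpa [Fin.sum_univ_three, smul_eq_C_mul] using hw
  have hinv (i : Fin 3) (hi : w i ≠ 0) : (C (w i)⁻¹ : Ternary) * C (w i) = 1 := by
    rw [← C_mul, inv_mul_cancel₀ hi, C_1]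
  have key {x y z : Ternary} (hx : IsLinearForm x) (hy : IsLinearForm y) (m n : ℂ)
      (hz : z = C m * x + C n * y) (p q r s t u : ℂ) :
      ∃ k l : Ternary, IsLinearForm k ∧ IsLinearForm l ∧
        C p * x ^ 2 + C q * (x * y) + C r * (x * z) +
        (C s * y ^ 2 + C t * (y * z) + C u * z ^ 2) = k * l := by
    obtain ⟨k, l, hk, hl, hkl⟩ := exists_factors_of_two_linear_forms hx hy
      (p + r * m + u * m ^ 2) (q + r * n + t * m + 2 * u * m * n) (s + t * n + u * n ^ 2)
    refine ⟨k, l, hk, hl, hkl ▸ ?_⟩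
    subst hz
    simp only [C_add, C_mul, C_pow, map_ofNat]
    ring
  fin_cases i
  · obtain ⟨k, l, hk, hl, hkl⟩ := key (z := a) hb hc (-((w 0)⁻¹ * w 1)) (-((w 0)⁻¹ * w 2)) (by
      simp only [C_neg, C_mul]
      linear_combination (-a) * hinv 0 hi + C (w 0)⁻¹ * hw) s t q u r p
    exact ⟨k, l, hk, hl, by rw [← hkl]; ring⟩
  · obtain ⟨k, l, hk, hl, hkl⟩ := key (z := b) ha hc (-((w 1)⁻¹ * w 0)) (-((w 1)⁻¹ * w 2)) (by
      simp only [C_neg, C_mul]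
      linear_combination (-b) * hinv 1 hi + C (w 1)⁻¹ * hw) p r q u t s
    exact ⟨k, l, hk, hl, by rw [← hkl]; ring⟩
  · exact key (z := c) ha hb (-((w 2)⁻¹ * w 0)) (-((w 2)⁻¹ * w 1)) (by
      simp only [C_neg, C_mul]
      linear_combination (-c) * hinv 2 hi + C (w 2)⁻¹ * hw) p q r s t u

/-- Linearly independent linear forms take arbitrary values at a suitable point. -/
lemma exists_eval_eq_of_linearIndependent {n : ℕ} {l : Fin n → Ternary}
    (hl : ∀ i, IsLinearForm (l i)) (h : LinearIndependent ℂ l) (v : Fin n → ℂ) :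
    ∃ P : Fin 3 → ℂ, ∀ i, eval P (l i) = v i := by
  obtain ⟨φ, hφ⟩ := ((Module.Basis.span h).constr ℂ v).exists_extend
  refine ⟨fun i => φ (X i), fun i => ?_⟩
  have hi : φ (l i) = v i := by
    have := LinearMap.congr_fun hφ (Module.Basis.span h i)
    rwa [Module.Basis.constr_basis, LinearMap.comp_apply, Submodule.subtype_apply,
      Module.Basis.span_apply] at this
  obtain ⟨w, hw⟩ := (hl i).exists_eq_X
  rw [← hi, hw]
  simp [← smul_eq_C_mul]

lemma not_tangent_and_secant {a b c b' c' : Ternary} {a₀ : ℂ} (ha : IsLinearForm a)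
    (hb : IsLinearForm b) (hb' : IsLinearForm b') (hc' : IsLinearForm c')
    (h : LinearIndependent ℂ ![a, b, c]) (h' : LinearIndependent ℂ ![a, b', c']) :
    a * c + b ^ 2 ≠ C a₀ * a ^ 2 + b' * c' := by
  intro heq
  obtain ⟨p, q, r, rfl⟩ := ha.exists_eq_of_linearIndependent hb' hc' hb h'
  have hl : ∀ i, IsLinearForm (![a, b', c'] i) := by
    intro i
    fin_cases i
    exacts [ha, hb', hc']
  have vanish (v : Fin 3 → ℂ) (h0 : v 0 = 0) (h12 : v 1 * v 2 = 0) :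
      q * v 1 + r * v 2 = 0 := by
    obtain ⟨P, hP⟩ := exists_eval_eq_of_linearIndependent hl h' v
    have h1 := hP 0
    have h2 := hP 1
    have h3 := hP 2
    simp only [Matrix.cons_val] at h1 h2 h3
    simpa [h1, h2, h3, h0, h12] using congrArg (eval P) heq
  have hq : q = 0 := by simpa using vanish ![0, 1, 0] (by simp) (by simp)
  have hr : r = 0 := by simpa using vanish ![0, 0, 1] (by simp) (by simp)
  have := Fintype.linearIndependent_iff.1 h ![p, -1, 0]
    (by simp [Fin.sum_univ_three, smul_eq_C_mul, hq, hr]) 1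
  simp at this

/-- For an irreducible ternary quadratic form `f` and a nonzero linear form `a`,
exactly one of the two normal forms holds. -/
theorem irreducible_quadratic_tangent_or_secant (f a : Ternary)
    (hf : MvPolynomial.IsHomogeneous f 2)
    (hirr : ¬ ∃ b c : Ternary, IsLinearForm b ∧ IsLinearForm c ∧ f = b * c)
    (ha : IsLinearForm a) (hane : a ≠ 0) :
    Xor'
      (∃ b c : Ternary, IsLinearForm b ∧ IsLinearForm c ∧
        LinearIndependent ℂ ![a, b, c] ∧ f = a * c + b ^ 2)
      (∃ (a₀ : ℂ) (b c : Ternary), a₀ ≠ 0 ∧ IsLinearForm b ∧ IsLinearForm c ∧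
        LinearIndependent ℂ ![a, b, c] ∧ f = MvPolynomial.C a₀ * a ^ 2 + b * c) := by
  refine (xor_iff_or_and_not_and _ _).2 ?_
  have indep {b c : Ternary} (hb : IsLinearForm b) (hc : IsLinearForm c) (p q r s t u : ℂ)
      (hfe : f = C p * a ^ 2 + C q * (a * b) + C r * (a * c) +
        (C s * b ^ 2 + C t * (b * c) + C u * c ^ 2)) : LinearIndependent ℂ ![a, b, c] := by
    by_contra hdep
    obtain ⟨x, y, hx, hy, hxy⟩ :=
      exists_factors_of_not_linearIndependent ha hb hc hdep p q r s t u
    exact hirr ⟨x, y, hx, hy, hfe.trans hxy⟩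
  constructor
  · obtain ⟨y, z, hy, hz, hs⟩ := ha.exists_spanning_triple hane
    obtain ⟨p, q, r, α, β, γ, hfe⟩ := exists_eq_quadratic_of_spanning hf hs
    obtain ⟨s, t, u, v, rfl, rfl, rfl⟩ := Complex.exists_binary_quadratic_factors α β γ
    by_cases hD : s * v - t * u = 0
    · left
      obtain ⟨m, n, hm, hmn, hn⟩ := Complex.exists_sq_of_discrim_eq_zero
        (α := s * u) (β := s * v + t * u) (γ := t * v)
        (by linear_combination (s * v - t * u) * hD)
      have hb := (hy.C_mul m).add (hz.C_mul n)
      have hc := ((ha.C_mul p).add (hy.C_mul q)).add (hz.C_mul r)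
      have hfe' : f = a * (C p * a + C q * y + C r * z) + (C m * y + C n * z) ^ 2 := by
        rw [hfe, hm, hmn, hn]
        simp only [C_mul, C_pow, map_ofNat]
        ring
      refine ⟨_, _, hb, hc, indep hb hc 0 0 1 1 0 0 ?_, hfe'⟩
      rw [hfe']
      simp
    · right
      have hinv := mul_inv_cancel₀ hD
      obtain ⟨β, γ, rfl, rfl⟩ : ∃ β γ : ℂ, q = β * s + γ * u ∧ r = β * t + γ * v :=
        ⟨(q * v - r * u) / (s * v - t * u), (r * s - q * t) / (s * v - t * u),
          by linear_combination (-q) * hinv, by linear_combination (-r) * hinv⟩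
      have hb := ((hy.C_mul s).add (hz.C_mul t)).add (ha.C_mul γ)
      have hc := ((hy.C_mul u).add (hz.C_mul v)).add (ha.C_mul β)
      have hfe' : f = C (p - β * γ) * a ^ 2 +
          (C s * y + C t * z + C γ * a) * (C u * y + C v * z + C β * a) := by
        rw [hfe]
        simp only [C_add, C_sub, C_mul]
        ring
      refine ⟨p - β * γ, _, _, fun h0 => hirr ⟨_, _, hb, hc, ?_⟩, hb, hc,
        indep hb hc (p - β * γ) 0 0 0 1 0 ?_, hfe'⟩
      · rw [hfe', h0]
        simp
      · rw [hfe']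
        simp
  · rintro ⟨⟨b, c, hb, hc, h, rfl⟩, a₀, b', c', -, hb', hc', h', heq⟩
    exact not_tangent_and_secant ha hb hb' hc' h h' heq
end

section
/- For a ternary cubic form f over ℂ the following are equivalent: (i) rank(f) = 2; (ii) f = a³ + b³ for some linearly independent linear forms a, b; (iii) f = a·b·c for some linear forms a, b, c which are linearly dependent but pairwise linearly independent. -/
open MvPolynomial

theorem IsLinearForm.lincomb {a b : Ternary} (ha : IsLinearForm a) (hb : IsLinearForm b)
    (s t : ℂ) : IsLinearForm (s • a + t • b) :=
  (homogeneousSubmodule (Fin 3) ℂ 1).add_mem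
    ((homogeneousSubmodule (Fin 3) ℂ 1).smul_mem s ha)
    ((homogeneousSubmodule (Fin 3) ℂ 1).smul_mem t hb)

theorem IsLinearForm.zero : IsLinearForm 0 := isHomogeneous_zero _ _ _

/-- A linear functional on polynomials agrees on linear forms with evaluation at a point. -/
theorem IsLinearForm.apply_eq_eval {a : Ternary} (ha : IsLinearForm a) (φ : Ternary →ₗ[ℂ] ℂ) :
    φ a = eval (fun i => φ (X i)) a := by
  have h : a ∈ Submodule.span ℂ (Set.range (X : Fin 3 → Ternary)) := by
    rw [← homogeneousSubmodule_one_eq_span_X]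
    exact ha
  clear ha
  induction h using Submodule.span_induction with
  | mem x hx => obtain ⟨i, rfl⟩ := hx; simp
  | zero => simp
  | add x y _ _ hx hy => rw [map_add, map_add, hx, hy]
  | smul c x _ hx => rw [map_smul, smul_eval, hx, smul_eq_mul]

/-- Independent linear forms `a`, `b` take any prescribed values `s`, `t` at some point, which can
be chosen so that the value of a third form `l` depends linearly on `(s, t)`. -/
theorem exists_eval_eq_of_linearIndependent_s2 {a b : Ternary} (ha : IsLinearForm a)
    (hb : IsLinearForm b) (hab : LinearIndependent ℂ ![a, b]) (l : Ternary)
    (hl : IsLinearForm l) :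
    ∃ u v : ℂ, ∀ s t : ℂ, ∃ p : Fin 3 → ℂ,
      eval p a = s ∧ eval p b = t ∧ eval p l = u * s + v * t := by
  obtain ⟨g, hg⟩ := (Finsupp.linearCombination ℂ ![a, b]).exists_leftInverse_of_injective
    (LinearMap.ker_eq_bot.mpr hab)
  have h0 : g a = Finsupp.single 0 1 := by
    simpa using LinearMap.congr_fun hg (Finsupp.single 0 1)
  have h1 : g b = Finsupp.single 1 1 := by
    simpa using LinearMap.congr_fun hg (Finsupp.single 1 1)
  refine ⟨g l 0, g l 1, fun s t => ?_⟩
  let φ : Ternary →ₗ[ℂ] ℂ := s • (Finsupp.lapply 0 ∘ₗ g) + t • (Finsupp.lapply 1 ∘ₗ g)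
  refine ⟨fun i => φ (X i), ?_, ?_, ?_⟩
  · rw [← ha.apply_eq_eval]; simp [φ, h0]
  · rw [← hb.apply_eq_eval]; simp [φ, h1]
  · rw [← hl.apply_eq_eval]; simp [φ]; ring

theorem add_cubes_ne_cube {a b l : Ternary} (ha : IsLinearForm a) (hb : IsLinearForm b)
    (hl : IsLinearForm l) (hab : LinearIndependent ℂ ![a, b]) : a ^ 3 + b ^ 3 ≠ l ^ 3 := by
  intro h
  obtain ⟨u, v, huv⟩ := exists_eval_eq_of_linearIndependent_s2 ha hb hab l hl
  have key : ∀ s t : ℂ, s ^ 3 + t ^ 3 = (u * s + v * t) ^ 3 := by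
    intro s t
    obtain ⟨p, hpa, hpb, hpl⟩ := huv s t
    simpa [hpa, hpb, hpl] using congrArg (eval p) h
  have h1 : u ^ 3 = 1 := by linear_combination -key 1 0
  have h2 : u - v = 0 := pow_eq_zero_iff (n := 3) (by norm_num) |>.mp
    (by linear_combination -key 1 (-1))
  obtain rfl : u = v := sub_eq_zero.mp h2
  have h3 : (6 : ℂ) = 0 := by linear_combination - 8 * h1 - key 1 1
  norm_num at h3

theorem exists_cube_eq_add_cubes_of_not_linearIndependent {a b : Ternary}
    (ha : IsLinearForm a) (hb : IsLinearForm b) (hab : ¬ LinearIndependent ℂ ![a, b]) :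
    ∃ l : Ternary, IsLinearForm l ∧ a ^ 3 + b ^ 3 = l ^ 3 := by
  have main : ∀ {x y : Ternary} {s t : ℂ}, IsLinearForm x → s • x + t • y = 0 → t ≠ 0 →
      ∃ l : Ternary, IsLinearForm l ∧ x ^ 3 + y ^ 3 = l ^ 3 := by
    intro x y s t hx hst ht
    obtain ⟨γ, hγ⟩ := IsAlgClosed.exists_pow_nat_eq (1 + (-s / t) ^ 3) (n := 3) (by norm_num)
    have hy : y = (-s / t) • x := by
      have : t • y = (-s) • x := by
        rw [neg_smul]; exact eq_neg_of_add_eq_zero_right hst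
      rw [div_eq_inv_mul, mul_smul, ← this, smul_smul, inv_mul_cancel₀ ht, one_smul]
    refine ⟨γ • x, by simpa using hx.lincomb IsLinearForm.zero γ 0, ?_⟩
    rw [smul_pow, hγ, hy, smul_pow, add_smul, one_smul]
  rw [LinearIndependent.pair_iff] at hab
  push Not at hab
  obtain ⟨s, t, hst, h⟩ := hab
  by_cases ht : t = 0
  · have hs : s ≠ 0 := fun hs => h hs ht
    rw [add_comm] at hst ⊢
    exact main hb hst hs
  · exact main ha hst ht

theorem waringRank_le {d r : ℕ} {f : Ternary} (l : Fin r → Ternary)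
    (hl : ∀ i, IsLinearForm (l i)) (hf : f = ∑ i, l i ^ d) : waringRank d f ≤ r :=
  Nat.sInf_le ⟨l, hl, hf⟩

theorem waringRank_three_eq_two_iff (f : Ternary) :
    waringRank 3 f = 2 ↔ ∃ a b : Ternary, IsLinearForm a ∧ IsLinearForm b ∧
      LinearIndependent ℂ ![a, b] ∧ f = a ^ 3 + b ^ 3 := by
  constructor
  · intro h
    have hmem := Nat.sInf_mem (Nat.nonempty_of_pos_sInf (by
      change 0 < waringRank 3 f
      omega))
    change waringRank 3 f ∈ _ at hmem
    rw [h] at hmem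
    obtain ⟨l, hl, hf⟩ := hmem
    rw [Fin.sum_univ_two] at hf
    refine ⟨l 0, l 1, hl 0, hl 1, ?_, hf⟩
    by_contra hli
    obtain ⟨m, hm, hm3⟩ :=
      exists_cube_eq_add_cubes_of_not_linearIndependent (hl 0) (hl 1) hli
    have := waringRank_le (d := 3) (f := f) (fun _ : Fin 1 => m) (fun _ => hm)
      (by simp [hf, hm3])
    omega
  · rintro ⟨a, b, ha, hb, hab, rfl⟩
    apply le_antisymm
    · exact waringRank_le ![a, b] (by simp [Fin.forall_fin_two, ha, hb]) (by simp)
    · refine le_csInf ⟨2, ![a, b], by simp [Fin.forall_fin_two, ha, hb], by simp⟩ ?_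
      rintro r ⟨l, hl, hf⟩
      by_contra hr
      have hr : r = 0 ∨ r = 1 := by omega
      rcases hr with rfl | rfl
      · exact add_cubes_ne_cube ha hb IsLinearForm.zero hab (by simpa using hf)
      · exact add_cubes_ne_cube ha hb (hl 0) hab (by simpa using hf)

theorem exists_sq_add_add_one_eq_zero : ∃ ω : ℂ, ω ^ 2 + ω + 1 = 0 := by
  obtain ⟨s, hs⟩ := IsAlgClosed.exists_pow_nat_eq (-3 : ℂ) (n := 2) (by norm_num)
  exact ⟨(-1 + s) / 2, by linear_combination hs / 4⟩

theorem sub_sq_ne_zero_of_sq_add_add_one {ω : ℂ} (hω : ω ^ 2 + ω + 1 = 0) :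
    ω - ω ^ 2 ≠ 0 := by
  intro h
  have : (3 : ℂ) = 0 := by linear_combination (4 - (2 * ω + 1)) * hω - (2 * ω + 1) * h
  norm_num at this

theorem exists_mul_eq_add_cubes {a b : Ternary} (ha : IsLinearForm a) (hb : IsLinearForm b)
    (hab : LinearIndependent ℂ ![a, b]) :
    ∃ x y z : Ternary, IsLinearForm x ∧ IsLinearForm y ∧ IsLinearForm z ∧
      ¬ LinearIndependent ℂ ![x, y, z] ∧ LinearIndependent ℂ ![x, y] ∧
      LinearIndependent ℂ ![y, z] ∧ LinearIndependent ℂ ![x, z] ∧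
      a ^ 3 + b ^ 3 = x * y * z := by
  obtain ⟨ω, hω⟩ := exists_sq_add_add_one_eq_zero
  have hne := sub_sq_ne_zero_of_sq_add_add_one hω
  have hC : (C ω : Ternary) ^ 2 + C ω + 1 = 0 := by
    simpa using congrArg (C : ℂ → Ternary) hω
  refine ⟨(1 : ℂ) • a + (1 : ℂ) • b, (1 : ℂ) • a + ω • b, (1 : ℂ) • a + (ω ^ 2) • b,
    ha.lincomb hb _ _, ha.lincomb hb _ _, ha.lincomb hb _ _, ?_, ?_, ?_, ?_, ?_⟩
  · rw [Fintype.not_linearIndependent_iff]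
    refine ⟨![1, ω, ω ^ 2], ?_, 0, by simp⟩
    simp only [Fin.sum_univ_three, smul_eq_C_mul, Matrix.cons_val, map_one, map_pow]
    linear_combination (a + b * (1 + C ω ^ 2 - C ω)) * hC
  · refine (LinearIndependent.pair_add_smul_add_smul_iff _ _ _ _).mpr ⟨hab, fun h => hne ?_⟩
    linear_combination -ω * h
  · refine (LinearIndependent.pair_add_smul_add_smul_iff _ _ _ _).mpr ⟨hab, fun h => hne ?_⟩
    linear_combination -h
  · refine (LinearIndependent.pair_add_smul_add_smul_iff _ _ _ _).mpr ⟨hab, fun h => hne ?_⟩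
    linear_combination ω ^ 2 * h - (ω ^ 2 - ω) * hω
  · simp only [smul_eq_C_mul, map_one, map_pow]
    linear_combination (-a ^ 2 * b - a * b ^ 2 * C ω + b ^ 3 * (1 - C ω)) * hC

theorem exists_add_cubes_eq_mul {a b c : Ternary} (ha : IsLinearForm a) (hb : IsLinearForm b)
    (habc : ¬ LinearIndependent ℂ ![a, b, c]) (hab : LinearIndependent ℂ ![a, b])
    (hbc : LinearIndependent ℂ ![b, c]) (hac : LinearIndependent ℂ ![a, c]) :
    ∃ x y : Ternary, IsLinearForm x ∧ IsLinearForm y ∧ LinearIndependent ℂ ![x, y] ∧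
      a * b * c = x ^ 3 + y ^ 3 := by
  obtain ⟨ω, hω⟩ := exists_sq_add_add_one_eq_zero
  have hne := sub_sq_ne_zero_of_sq_add_add_one hω
  rw [Fintype.not_linearIndependent_iff] at habc
  obtain ⟨g, hg, i, hi⟩ := habc
  simp only [Fin.sum_univ_three, Matrix.cons_val] at hg
  have hg_ne : g 0 ≠ 0 ∨ g 1 ≠ 0 ∨ g 2 ≠ 0 := by fin_cases i <;> tauto
  rw [LinearIndependent.pair_iff] at hbc hac
  have hab' := LinearIndependent.pair_iff.mp hab
  have h0 : g 0 ≠ 0 := by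
    intro h
    have := hbc (g 1) (g 2) (by simpa [h] using hg)
    tauto
  have h1 : g 1 ≠ 0 := by
    intro h
    have := hac (g 0) (g 2) (by simpa [h] using hg)
    tauto
  have h2 : g 2 ≠ 0 := by
    intro h
    have := hab' (g 0) (g 1) (by simpa [h] using hg)
    tauto
  obtain ⟨γ, hγ⟩ := IsAlgClosed.exists_pow_nat_eq
    ((3 * (ω - ω ^ 2) * (g 0 * g 1 * g 2))⁻¹) (n := 3) (by norm_num)
  have hk : 3 * (ω - ω ^ 2) * (g 0 * g 1 * g 2) ≠ 0 := by simp [hne, h0, h1, h2]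
  have hγ3 : γ ^ 3 * (3 * (ω - ω ^ 2) * (g 0 * g 1 * g 2)) = 1 := by
    rw [hγ, inv_mul_cancel₀ hk]
  have hγ0 : γ ≠ 0 := by rintro rfl; simp at hγ3
  refine ⟨(γ * g 0) • a + (-γ * ω * g 1) • b, (-γ * g 0) • a + (γ * ω ^ 2 * g 1) • b,
    ha.lincomb hb _ _, ha.lincomb hb _ _, ?_, ?_⟩
  · refine (LinearIndependent.pair_add_smul_add_smul_iff _ _ _ _).mpr ⟨hab, fun h => ?_⟩
    have : γ ^ 2 * (g 0 * g 1) * (ω - ω ^ 2) = 0 := by linear_combination -h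
    simp [hγ0, h0, h1, hne] at this
  · have hC : (C ω : Ternary) ^ 2 + C ω + 1 = 0 := by
      simpa using congrArg (C : ℂ → Ternary) hω
    have hCγ : (C γ : Ternary) ^ 3 * (3 * (C ω - C ω ^ 2) * (C (g 0) * C (g 1) * C (g 2))) = 1 := by
      have h3 : (C 3 : Ternary) = 3 := map_ofNat C 3
      simpa [h3] using congrArg (C : ℂ → Ternary) hγ3
    simp only [smul_eq_C_mul, map_mul, map_neg, map_pow] at hg ⊢
    linear_combination (-(a * b * c)) * hCγ
      + C γ ^ 3 * (3 * (C ω - C ω ^ 2)) * (C (g 0) * a) * (C (g 1) * b) * hg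
      + C γ ^ 3 * (-3 * (C (g 0) * a) * (C (g 1) * b) ^ 2 * C ω * (1 - C ω)
        + (C (g 1) * b) ^ 3 * C ω ^ 3 * (1 - C ω)) * hC

/-- Characterization of ternary cubic forms of Waring rank 2. -/
theorem cubic_rank_two_iff (f : Ternary) (hf : MvPolynomial.IsHomogeneous f 3) :
    (waringRank 3 f = 2 ↔
      ∃ a b : Ternary, IsLinearForm a ∧ IsLinearForm b ∧
        LinearIndependent ℂ ![a, b] ∧ f = a ^ 3 + b ^ 3) ∧
    (waringRank 3 f = 2 ↔
      ∃ a b c : Ternary, IsLinearForm a ∧ IsLinearForm b ∧ IsLinearForm c ∧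
        ¬ LinearIndependent ℂ ![a, b, c] ∧
        LinearIndependent ℂ ![a, b] ∧ LinearIndependent ℂ ![b, c] ∧
        LinearIndependent ℂ ![a, c] ∧ f = a * b * c) := by
  have hdec := waringRank_three_eq_two_iff f
  refine ⟨hdec, hdec.trans ⟨?_, ?_⟩⟩
  · rintro ⟨a, b, ha, hb, hab, rfl⟩
    exact exists_mul_eq_add_cubes ha hb hab
  · rintro ⟨a, b, c, ha, hb, -, habc, hab, hbc, hac, rfl⟩
    exact exists_add_cubes_eq_mul ha hb habc hab hbc hac
end

section
/- If f = a²·b for linearly independent linear forms a and b over ℂ, then the Waring rank of the ternary cubic form f equals 3. -/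
open MvPolynomial

theorem IsLinearForm.eval_combination {l : Ternary} (hl : IsLinearForm l) (x y : ℂ)
    (p q : Fin 3 → ℂ) :
    eval (x • p + y • q) l = x * eval p l + y * eval q l := by
  have hspan : l ∈ Submodule.span ℂ (Set.range X) := by
    rwa [← homogeneousSubmodule_one_eq_span_X, mem_homogeneousSubmodule]
  clear hl
  induction hspan using Submodule.span_induction with
  | mem _ h => obtain ⟨i, rfl⟩ := h; simp
  | zero => simp
  | add f g _ _ hf hg => simp only [map_add, hf, hg]; ring
  | smul c f _ hf => simp only [smul_eval, hf]; ring

theorem exists_eval_det_ne_zero {a b : Ternary} (hind : LinearIndependent ℂ ![a, b]) :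
    ∃ p q : Fin 3 → ℂ, eval p a * eval q b - eval q a * eval p b ≠ 0 := by
  by_contra! h
  rw [LinearIndependent.pair_iff] at hind
  have hzero (p : Fin 3 → ℂ) : eval p a = 0 := by
    have := (hind (eval p b) (-eval p a) (MvPolynomial.funext fun q => by
      simp only [map_add, smul_eval, map_zero]
      linear_combination -h p q)).2
    simpa using this
  have ha : a = 0 := MvPolynomial.funext fun p => by simpa using hzero p
  simpa using (hind 1 0 (by simp [ha])).1

/-- Points dual to a pair of linearly independent linear forms. -/
theorem exists_dual_points {a b : Ternary} (ha : IsLinearForm a) (hb : IsLinearForm b)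
    (hind : LinearIndependent ℂ ![a, b]) :
    ∃ p q : Fin 3 → ℂ, eval p a = 1 ∧ eval p b = 0 ∧ eval q a = 0 ∧ eval q b = 1 := by
  obtain ⟨p, q, h⟩ := exists_eval_det_ne_zero hind
  set D := eval p a * eval q b - eval q a * eval p b with hD
  refine ⟨(eval q b / D) • p + (-eval p b / D) • q, (-eval q a / D) • p + (eval p a / D) • q,
    ?_, ?_, ?_, ?_⟩ <;>
  simp only [ha.eval_combination, hb.eval_combination] <;> field_simp <;> rw [hD] <;> ring

/-- The binary cubic `x² y` is not a sum of two cubes of linear forms. -/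
theorem sq_mul_ne_add_cubes (l₁ l₂ m₁ m₂ : ℂ) :
    ¬ ∀ x y : ℂ, x ^ 2 * y = (x * l₁ + y * l₂) ^ 3 + (x * m₁ + y * m₂) ^ 3 := by
  intro h
  have h₁ : l₁ ^ 3 + m₁ ^ 3 = 0 := by linear_combination -h 1 0
  have h₂ : l₂ ^ 3 + m₂ ^ 3 = 0 := by linear_combination -h 0 1
  have h₃ : l₁ * l₂ ^ 2 + m₁ * m₂ ^ 2 = 0 := by
    linear_combination (-1 / 6) * h 1 1 + (-1 / 6) * h 1 (-1) - (1 / 3) * h₁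
  have h₄ : 3 * (l₁ ^ 2 * l₂ + m₁ ^ 2 * m₂) = 1 := by
    linear_combination (-1 / 2) * h 1 1 + (1 / 2) * h 1 (-1) - h₂
  by_cases hdet : l₁ * m₂ - l₂ * m₁ = 0
  · have hl : l₁ = 0 := by
      linear_combination (-l₁) * h₄ + 3 * l₂ * h₁ + 3 * m₁ ^ 2 * hdet
    have hm : m₁ = 0 := by
      linear_combination (-m₁) * h₄ + 3 * m₂ * h₁ - 3 * l₁ ^ 2 * hdet
    simp [hl, hm] at h₄
  · have hl : l₂ = 0 := by
      have : (l₁ * m₂ - l₂ * m₁) * l₂ ^ 2 = 0 := by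
        linear_combination m₂ * h₃ - m₁ * h₂
      simpa [hdet] using this
    have hm : m₂ = 0 := by
      have : (l₁ * m₂ - l₂ * m₁) * m₂ ^ 2 = 0 := by
        linear_combination l₁ * h₂ - l₂ * h₃
      simpa [hdet] using this
    simp [hl, hm] at h₄

theorem sq_mul_ne_add_cubes_of_linearIndependent {a b l m : Ternary} (ha : IsLinearForm a)
    (hb : IsLinearForm b) (hind : LinearIndependent ℂ ![a, b]) (hl : IsLinearForm l)
    (hm : IsLinearForm m) : a ^ 2 * b ≠ l ^ 3 + m ^ 3 := by
  intro h
  obtain ⟨p, q, hpa, hpb, hqa, hqb⟩ := exists_dual_points ha hb hind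
  refine sq_mul_ne_add_cubes (eval p l) (eval q l) (eval p m) (eval q m) fun x y => ?_
  have := congrArg (eval (x • p + y • q)) h
  simpa [-smul_add, ha.eval_combination, hb.eval_combination, hl.eval_combination,
    hm.eval_combination, hpa, hpb, hqa, hqb] using this

theorem exists_sq_mul_eq_sum_three_cubes {a b : Ternary} (ha : IsLinearForm a)
    (hb : IsLinearForm b) :
    ∃ l : Fin 3 → Ternary, (∀ i, IsLinearForm (l i)) ∧ a ^ 2 * b = ∑ i, l i ^ 3 := by
  obtain ⟨c, hc⟩ := IsAlgClosed.exists_pow_nat_eq (1 / 6 : ℂ) (n := 3) (by norm_num)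
  obtain ⟨e, he⟩ := IsAlgClosed.exists_pow_nat_eq (-1 / 3 : ℂ) (n := 3) (by norm_num)
  have hsmul (z : ℂ) {l : Ternary} (hl : IsLinearForm l) : IsLinearForm (C z * l) := by
    simpa [IsLinearForm] using (isHomogeneous_C (Fin 3) z).mul hl
  refine ⟨![C c * (a + b), C c * (b - a), C e * b], ?_, ?_⟩
  · intro i
    fin_cases i
    · exact hsmul c (ha.add hb)
    · exact hsmul c (hb.sub ha)
    · exact hsmul e hb
  · refine MvPolynomial.funext fun v => ?_
    simp only [Fin.sum_univ_three, Matrix.cons_val, map_add, map_mul, map_pow, map_sub, eval_C]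
    linear_combination (-((eval v a + eval v b) ^ 3 + (eval v b - eval v a) ^ 3)) * hc
      - (eval v b) ^ 3 * he

/-- If `f = a² b` for linearly independent linear forms, then `rank f = 3`. -/
theorem rank_sq_times_linear (a b : Ternary) (ha : IsLinearForm a) (hb : IsLinearForm b)
    (hind : LinearIndependent ℂ ![a, b]) :
    waringRank 3 (a ^ 2 * b) = 3 := by
  refine le_antisymm (Nat.sInf_le (exists_sq_mul_eq_sum_three_cubes ha hb)) ?_
  refine le_csInf ⟨3, exists_sq_mul_eq_sum_three_cubes ha hb⟩ ?_
  rintro r ⟨l, hl, h⟩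
  by_contra! hr
  have h₀ : IsLinearForm 0 := isHomogeneous_zero _ _ _
  interval_cases r
  · exact sq_mul_ne_add_cubes_of_linearIndependent ha hb hind h₀ h₀ (by simpa using h)
  · exact sq_mul_ne_add_cubes_of_linearIndependent ha hb hind (hl 0) h₀ (by simpa using h)
  · exact sq_mul_ne_add_cubes_of_linearIndependent ha hb hind (hl 0) (hl 1)
      (by simpa [Fin.sum_univ_two] using h)
end

section
/- If f = a³ + b³ + c³ for linearly independent linear forms a, b, c over ℂ, then the Waring rank of the ternary cubic form f equals 3. -/
open MvPolynomial

/-- A homogeneous polynomial of degree one is a linear combination of the variables. -/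
theorem MvPolynomial.IsHomogeneous.exists_eq_linearCombination_X {σ R : Type*} [Fintype σ]
    [CommSemiring R] {p : MvPolynomial σ R} (hp : p.IsHomogeneous 1) :
    ∃ α : σ → R, p = Fintype.linearCombination R (X : σ → MvPolynomial σ R) α := by
  have h : p ∈ Submodule.span R (Set.range (X : σ → MvPolynomial σ R)) := by
    rwa [← homogeneousSubmodule_one_eq_span_X, mem_homogeneousSubmodule]
  rw [← Fintype.range_linearCombination] at h
  obtain ⟨α, hα⟩ := h
  exact ⟨α, hα.symm⟩

/-- Evaluating a linear combination of the variables is taking a dot product. -/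
theorem MvPolynomial.eval_linearCombination_X {σ R : Type*} [Fintype σ] [CommSemiring R]
    (α w : σ → R) :
    eval w (Fintype.linearCombination R (X : σ → MvPolynomial σ R) α) = α ⬝ᵥ w := by
  simp [Fintype.linearCombination_apply, smul_eval, dotProduct]

/-- A sum of cubes of as many linearly independent linear forms as there are variables is not a
sum of fewer cubes of linear forms. -/
theorem MvPolynomial.card_le_of_sum_cubes_eq {σ ι K : Type*} [Fintype σ] [Fintype ι] [Field K]
    [CharZero K] {g : σ → MvPolynomial σ K} {l : ι → MvPolynomial σ K}
    (hg : ∀ i, (g i).IsHomogeneous 1) (hind : LinearIndependent K g)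
    (hl : ∀ i, (l i).IsHomogeneous 1) (h : ∑ i, g i ^ 3 = ∑ i, l i ^ 3) :
    Fintype.card σ ≤ Fintype.card ι := by
  classical
  by_contra! hlt
  choose A hA using fun i ↦ (hg i).exists_eq_linearCombination_X
  choose B hB using fun i ↦ (hl i).exists_eq_linearCombination_X
  have hAind : LinearIndependent K (Matrix.of A).row := by
    refine LinearIndependent.of_comp (Fintype.linearCombination K (X : σ → MvPolynomial σ K)) ?_
    rwa [_root_.funext hA] at hind
  have hunit := Matrix.linearIndependent_rows_iff_isUnit.mp hAind
  have hker : LinearMap.ker (Matrix.of B).mulVecLin ≠ ⊥ :=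
    LinearMap.ker_ne_bot_of_finrank_lt (by simpa using hlt)
  obtain ⟨v, hv, hv0⟩ := Submodule.exists_mem_ne_zero_of_ne_bot hker
  have hBv (i : ι) : B i ⬝ᵥ v = 0 := congrFun (LinearMap.mem_ker.mp hv) i
  have key (w : σ → K) : ∑ i, (A i ⬝ᵥ w + A i ⬝ᵥ v) ^ 3 = ∑ i, (A i ⬝ᵥ w) ^ 3 := by
    have h1 := congrArg (eval (w + v)) h
    have h2 := congrArg (eval w) h
    simp only [map_sum, map_pow, hA, hB, eval_linearCombination_X, dotProduct_add, hBv,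
      add_zero] at h1 h2
    rw [h1, h2]
  refine hv0 (Matrix.mulVec_injective_of_isUnit hunit ?_)
  rw [Matrix.mulVec_zero]
  funext i
  change A i ⬝ᵥ v = 0
  have hx (x : K) : x * (A i ⬝ᵥ v) * (x + A i ⬝ᵥ v) = 0 := by
    obtain ⟨w, hw⟩ := Matrix.mulVec_surjective_iff_isUnit.mpr hunit (Pi.single i x)
    have hw' (j : σ) : A j ⬝ᵥ w = Pi.single (M := fun _ ↦ K) i x j := congrFun hw j
    have h0 := key 0
    have h1 := key w
    simp only [hw', dotProduct_zero, zero_add] at h0 h1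
    rw [← Finset.add_sum_erase _ _ (Finset.mem_univ i)] at h0
    rw [← Finset.add_sum_erase _ _ (Finset.mem_univ i),
      ← Finset.add_sum_erase _ _ (Finset.mem_univ i),
      Finset.sum_congr rfl (g := fun j ↦ (A j ⬝ᵥ v) ^ 3),
      Finset.sum_eq_zero (s := Finset.univ.erase i)
        (f := fun j ↦ Pi.single (M := fun _ ↦ K) i x j ^ 3)] at h1
    · simp only [Pi.single_eq_same] at h1
      simp only [ne_eq, OfNat.ofNat_ne_zero, not_false_eq_true, zero_pow,
        Finset.sum_const_zero] at h0
      have h3 : (3 : K) * (x * (A i ⬝ᵥ v) * (x + A i ⬝ᵥ v)) = 0 := by linear_combination h1 - h0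
      simpa using h3
    · intro j hj
      simp [Finset.ne_of_mem_erase hj]
    · intro j hj
      simp [Finset.ne_of_mem_erase hj]
  have h2 : (2 : K) * (A i ⬝ᵥ v) = 0 := by linear_combination hx 1 + hx (-1)
  simpa using h2

/-- If `f = a³ + b³ + c³` for linearly independent linear forms, then `rank f = 3`. -/
theorem rank_sum_three_cubes (a b c : Ternary)
    (ha : IsLinearForm a) (hb : IsLinearForm b) (hc : IsLinearForm c)
    (hind : LinearIndependent ℂ ![a, b, c]) :
    waringRank 3 (a ^ 3 + b ^ 3 + c ^ 3) = 3 := by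
  have hg : ∀ i, IsLinearForm (![a, b, c] i) := by
    simp [Fin.forall_fin_succ, ha, hb, hc]
  have hsum : a ^ 3 + b ^ 3 + c ^ 3 = ∑ i, ![a, b, c] i ^ 3 := by
    simp [Fin.sum_univ_three]
  refine IsLeast.csInf_eq ⟨⟨![a, b, c], hg, hsum⟩, ?_⟩
  rintro r ⟨l, hl, h⟩
  simpa using card_le_of_sum_cubes_eq hg hind hl (hsum.symm.trans h)
end

section
/- For a ternary cubic form f over ℂ the following are equivalent: (i) Hess(f) = a²·b for some linearly independent linear forms a, b; (ii) f = a²·c + b³ for some linearly independent linear forms a, b, c. When these conditions hold, the Waring rank of f equals 4. -/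
open MvPolynomial

/-- The value at `(x, y, z)` of the Hessian determinant of the cubic
`a z³ + (l₁ x + l₂ y) z² + (q₀ x² + q₁ x y + q₂ y²) z + g₀ x³ + g₁ x² y + g₂ x y² + g₃ y³`. -/
def hessVal (a l₁ l₂ q₀ q₁ q₂ g₀ g₁ g₂ g₃ x y z : ℂ) : ℂ :=
  Matrix.det !![2 * q₀ * z + 6 * g₀ * x + 2 * g₁ * y, q₁ * z + 2 * g₁ * x + 2 * g₂ * y,
      2 * l₁ * z + 2 * q₀ * x + q₁ * y;
    q₁ * z + 2 * g₁ * x + 2 * g₂ * y, 2 * q₂ * z + 2 * g₂ * x + 6 * g₃ * y,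
      2 * l₂ * z + q₁ * x + 2 * q₂ * y;
    2 * l₁ * z + 2 * q₀ * x + q₁ * y, 2 * l₂ * z + q₁ * x + 2 * q₂ * y,
      6 * a * z + 2 * (l₁ * x + l₂ * y)]

theorem hessVal_eq (a l₁ l₂ q₀ q₁ q₂ g₀ g₁ g₂ g₃ x y z : ℂ) :
    hessVal a l₁ l₂ q₀ q₁ q₂ g₀ g₁ g₂ g₃ x y z =
      (2 * q₀ * z + 6 * g₀ * x + 2 * g₁ * y) *
        ((2 * q₂ * z + 2 * g₂ * x + 6 * g₃ * y) * (6 * a * z + 2 * (l₁ * x + l₂ * y)) -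
          (2 * l₂ * z + q₁ * x + 2 * q₂ * y) ^ 2) -
      (q₁ * z + 2 * g₁ * x + 2 * g₂ * y) ^ 2 * (6 * a * z + 2 * (l₁ * x + l₂ * y)) +
      2 * (q₁ * z + 2 * g₁ * x + 2 * g₂ * y) * (2 * l₁ * z + 2 * q₀ * x + q₁ * y) *
        (2 * l₂ * z + q₁ * x + 2 * q₂ * y) -
      (2 * l₁ * z + 2 * q₀ * x + q₁ * y) ^ 2 * (2 * q₂ * z + 2 * g₂ * x + 6 * g₃ * y) := by
  simp only [hessVal, Matrix.det_fin_three, Matrix.of_apply, Matrix.cons_val]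
  ring

/-- The Hessian determinant is invariant under the shear `z ↦ z + m₁ x + m₂ y`. -/
theorem hessVal_shear (m₁ m₂ a l₁ l₂ q₀ q₁ q₂ g₀ g₁ g₂ g₃ x y z : ℂ) :
    hessVal a (l₁ + 3 * a * m₁) (l₂ + 3 * a * m₂) (q₀ + 2 * l₁ * m₁ + 3 * a * m₁ ^ 2)
      (q₁ + 2 * (l₁ * m₂ + l₂ * m₁) + 6 * a * m₁ * m₂) (q₂ + 2 * l₂ * m₂ + 3 * a * m₂ ^ 2)
      (g₀ + q₀ * m₁ + l₁ * m₁ ^ 2 + a * m₁ ^ 3)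
      (g₁ + q₀ * m₂ + q₁ * m₁ + 2 * l₁ * m₁ * m₂ + l₂ * m₁ ^ 2 + 3 * a * m₁ ^ 2 * m₂)
      (g₂ + q₁ * m₂ + q₂ * m₁ + l₁ * m₂ ^ 2 + 2 * l₂ * m₁ * m₂ + 3 * a * m₁ * m₂ ^ 2)
      (g₃ + q₂ * m₂ + l₂ * m₂ ^ 2 + a * m₂ ^ 3) x y z =
    hessVal a l₁ l₂ q₀ q₁ q₂ g₀ g₁ g₂ g₃ x y (z + m₁ * x + m₂ * y) := by
  simp only [hessVal_eq]
  ring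

/-- A binary quadratic form of vanishing discriminant over `ℂ` is a square. -/
theorem exists_sq_of_discrim_eq_zero {p q r : ℂ} (h : q ^ 2 = 4 * p * r) :
    ∃ s t : ℂ, p = s ^ 2 ∧ q = 2 * s * t ∧ r = t ^ 2 := by
  obtain ⟨s, rfl⟩ := IsAlgClosed.exists_pow_nat_eq p two_pos
  by_cases hs : s = 0
  · obtain ⟨t, rfl⟩ := IsAlgClosed.exists_pow_nat_eq r two_pos
    subst hs
    exact ⟨0, t, rfl, by simpa using h, rfl⟩
  · refine ⟨s, q / (2 * s), rfl, by field_simp, ?_⟩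
    field_simp
    linear_combination -h

section HessVal

variable {a l₁ l₂ q₀ q₁ q₂ g₀ g₁ g₂ g₃ k : ℂ}

theorem hessVal_cube_coeff_eq_zero_of_sq_coeff_eq_zero (hk : k ≠ 0)
    (h : ∀ x y z, hessVal a 0 0 q₀ q₁ q₂ g₀ g₁ g₂ g₃ x y z = k * x ^ 2 * y) : a = 0 := by
  by_contra ha
  simp only [hessVal_eq] at h
  have hq : a * (q₁ ^ 2 - 4 * q₀ * q₂) = 0 := by linear_combination (-1 / 6) * h 0 0 1
  obtain ⟨s, t, rfl, rfl, rfl⟩ := exists_sq_of_discrim_eq_zero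
    (sub_eq_zero.1 ((mul_eq_zero.1 hq).resolve_left ha))
  have hK : a * (s ^ 2 * (2 * g₂ + 6 * g₃) - 2 * s * t * (2 * g₁ + 2 * g₂) +
      t ^ 2 * (6 * g₀ + 2 * g₁)) = 0 := by
    linear_combination (1 / 24) * (h 1 1 1 + h 1 1 (-1) - 2 * h 1 1 0)
  replace hK := (mul_eq_zero.1 hK).resolve_left ha
  exact hk (by linear_combination -h 1 1 0 - 4 * (s + t) ^ 2 * hK)

theorem hessVal_cube_coeff_eq_zero (hk : k ≠ 0)
    (h : ∀ x y z, hessVal a l₁ l₂ q₀ q₁ q₂ g₀ g₁ g₂ g₃ x y z = k * x ^ 2 * y) : a = 0 := by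
  by_contra ha
  obtain ⟨m₁, hm₁⟩ : ∃ m, l₁ + 3 * a * m = 0 := ⟨-l₁ / (3 * a), by field_simp; ring⟩
  obtain ⟨m₂, hm₂⟩ : ∃ m, l₂ + 3 * a * m = 0 := ⟨-l₂ / (3 * a), by field_simp; ring⟩
  have h' := fun x y z => (hessVal_shear m₁ m₂ a l₁ l₂ q₀ q₁ q₂ g₀ g₁ g₂ g₃ x y z).trans (h _ _ _)
  rw [hm₁, hm₂] at h'
  exact ha (hessVal_cube_coeff_eq_zero_of_sq_coeff_eq_zero hk h')

theorem hessVal_sq_coeff_false_of_mul_coeff_eq_zero (hk : k ≠ 0) (hl : l₁ ≠ 0 ∨ l₂ ≠ 0)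
    (h : ∀ x y z, hessVal 0 l₁ l₂ 0 0 0 g₀ g₁ g₂ g₃ x y z = k * x ^ 2 * y) : False := by
  simp only [hessVal_eq] at h
  have hl' : k * (l₂ ^ 2 * l₁) = 0 := by linear_combination h l₂ (-l₁) 0
  rcases mul_eq_zero.1 ((mul_eq_zero.1 hl').resolve_left hk) with h₂ | rfl
  · obtain rfl : l₂ = 0 := by simpa using h₂
    have hl₁ : l₁ ≠ 0 := by simpa using hl
    have hg₂ : l₁ ^ 2 * g₂ = 0 := by linear_combination (-1 / 8) * (h 1 0 1 - h 1 0 0)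
    have hg₃ : l₁ ^ 2 * g₃ = 0 := by linear_combination (-1 / 24) * (h 0 1 1 - h 0 1 0)
    obtain rfl : g₂ = 0 := by simpa [hl₁] using hg₂
    obtain rfl : g₃ = 0 := by simpa [hl₁] using hg₃
    exact hk (by linear_combination (-1 / 2) * (h 1 1 0 - h 1 (-1) 0))
  · have hl₂ : l₂ ≠ 0 := by simpa using hl
    have hg₁ : l₂ ^ 2 * g₁ = 0 := by linear_combination (-1 / 8) * (h 0 1 1 - h 0 1 0)
    have hg₀ : l₂ ^ 2 * g₀ = 0 := by linear_combination (-1 / 24) * (h 1 0 1 - h 1 0 0)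
    obtain rfl : g₁ = 0 := by simpa [hl₂] using hg₁
    obtain rfl : g₀ = 0 := by simpa [hl₂] using hg₀
    exact hk (by linear_combination h 0 1 0 - h 1 1 0)

theorem hessVal_sq_coeff_eq_zero (hk : k ≠ 0)
    (h : ∀ x y z, hessVal 0 l₁ l₂ q₀ q₁ q₂ g₀ g₁ g₂ g₃ x y z = k * x ^ 2 * y) :
    l₁ = 0 ∧ l₂ = 0 := by
  by_contra! hl
  replace hl : l₁ ≠ 0 ∨ l₂ ≠ 0 := by tauto
  have hq : l₂ ^ 2 * q₀ - l₁ * l₂ * q₁ + l₁ ^ 2 * q₂ = 0 := by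
    have := h 0 0 1
    rw [hessVal_eq] at this
    linear_combination (-1 / 8) * this
  obtain ⟨m₁, m₂, h₀, h₁, h₂⟩ : ∃ m₁ m₂, q₀ + 2 * l₁ * m₁ = 0 ∧
      q₁ + 2 * (l₁ * m₂ + l₂ * m₁) = 0 ∧ q₂ + 2 * l₂ * m₂ = 0 := by
    rcases hl with hl | hl
    · refine ⟨-q₀ / (2 * l₁), (l₂ * q₀ / l₁ - q₁) / (2 * l₁), by field_simp; ring,
        by field_simp; ring, ?_⟩
      field_simp
      linear_combination hq
    · refine ⟨(l₁ * q₂ / l₂ - q₁) / (2 * l₂), -q₂ / (2 * l₂), ?_,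
        by field_simp; ring, by field_simp; ring⟩
      field_simp
      linear_combination hq
  have h' := fun x y z => (hessVal_shear m₁ m₂ 0 l₁ l₂ q₀ q₁ q₂ g₀ g₁ g₂ g₃ x y z).trans (h _ _ _)
  simp only [mul_zero, zero_mul, add_zero, h₀, h₁, h₂] at h'
  exact hessVal_sq_coeff_false_of_mul_coeff_eq_zero hk hl h'

theorem hessVal_eq_sq_mul (hk : k ≠ 0)
    (h : ∀ x y z, hessVal a l₁ l₂ q₀ q₁ q₂ g₀ g₁ g₂ g₃ x y z = k * x ^ 2 * y) :
    (a = 0 ∧ l₁ = 0 ∧ l₂ = 0 ∧ q₁ = 0 ∧ q₂ = 0 ∧ g₂ = 0) ∧ q₀ ≠ 0 ∧ g₃ ≠ 0 := by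
  obtain rfl := hessVal_cube_coeff_eq_zero hk h
  obtain ⟨rfl, rfl⟩ := hessVal_sq_coeff_eq_zero hk h
  simp only [hessVal_eq] at h
  have hQ : ∀ x y, (q₁ ^ 2 - 4 * q₀ * q₂) * (q₀ * x ^ 2 + q₁ * x * y + q₂ * y ^ 2) = 0 := by
    intro x y
    linear_combination (1 / 2) * (h x y 1 - h x y 0)
  have hd : q₁ ^ 2 - 4 * q₀ * q₂ = 0 := by
    by_contra hd
    have h₀ : q₀ = 0 := by simpa [hd] using hQ 1 0
    have h₁ : q₁ = 0 := by
      refine (mul_eq_zero.1 ?_).resolve_left hd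
      linear_combination hQ 1 1 - hQ 1 0 - hQ 0 1
    simp [h₀, h₁] at hd
  obtain ⟨s, t, rfl, rfl, rfl⟩ := exists_sq_of_discrim_eq_zero (sub_eq_zero.1 hd)
  have hst : k * (t ^ 2 * s) = 0 := by linear_combination h t (-s) 0
  rcases mul_eq_zero.1 ((mul_eq_zero.1 hst).resolve_left hk) with h₂ | rfl
  · obtain rfl : t = 0 := by simpa using h₂
    have hg₂ : s ^ 4 * g₂ = 0 := by linear_combination (-1 / 8) * h 1 0 0
    have hg₃ : s ^ 4 * g₃ = -k / 24 := by linear_combination (-1 / 24) * (h 1 1 0 - h 1 0 0)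
    have hne : s ^ 4 * g₃ ≠ 0 := by rw [hg₃]; simpa using hk
    have hs : s ≠ 0 := fun hs => hne (by simp [hs])
    exact ⟨⟨rfl, rfl, rfl, by ring, by ring, by simpa [hs] using hg₂⟩, by simpa using hs,
      right_ne_zero_of_mul hne⟩
  · refine absurd ?_ hk
    linear_combination (-1 / 2) * (h 1 1 0 - h 1 (-1) 0) + h 0 1 0

end HessVal

/-- The linear form with coefficient vector `v`. -/
noncomputable def linForm (v : Fin 3 → ℂ) : Ternary := ∑ i, C (v i) * X i

theorem isLinearForm_linForm (v : Fin 3 → ℂ) : IsLinearForm (linForm v) :=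
  IsHomogeneous.sum _ _ _ fun i _ => isHomogeneous_C_mul_X (v i) i

theorem exists_sum_mul_X {n : ℕ} {g : Ternary} (hg : g.IsHomogeneous (n + 1)) :
    ∃ q : Fin 3 → Ternary, (∀ i, (q i).IsHomogeneous n) ∧ g = ∑ i, q i * X i := by
  refine ⟨fun i => C ((n + 1 : ℂ)⁻¹) * pderiv i g, fun i => hg.pderiv.C_mul _, ?_⟩
  have h := hg.sum_X_mul_pderiv
  have hn : (n + 1 : ℂ) ≠ 0 := Nat.cast_add_one_ne_zero n
  calc g = C ((n + 1 : ℂ)⁻¹) * ((n + 1) • g) := by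
        rw [nsmul_eq_mul, ← mul_assoc, ← map_natCast C, ← C_mul]
        simp [hn]
    _ = _ := by
        rw [← h, Finset.mul_sum]
        exact Finset.sum_congr rfl fun i _ => by ring

theorem exists_C_of_isHomogeneous_zero {g : Ternary} (hg : g.IsHomogeneous 0) :
    ∃ r, g = C r :=
  ⟨_, totalDegree_eq_zero_iff_eq_C.1 ((totalDegree_zero_iff_isHomogeneous _).2 hg)⟩

theorem IsLinearForm.exists_eq_linForm {a : Ternary} (ha : IsLinearForm a) :
    ∃ v, a = linForm v := by
  obtain ⟨q, hq, rfl⟩ := exists_sum_mul_X (n := 0) ha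
  choose v hv using fun i => exists_C_of_isHomogeneous_zero (hq i)
  exact ⟨v, by simp only [linForm, hv]⟩

theorem exists_quadratic_coeffs {g : Ternary} (hg : g.IsHomogeneous 2) :
    ∃ a b c d e h : ℂ, g = C a * X 0 ^ 2 + C b * X 0 * X 1 + C c * X 1 ^ 2 +
      C d * X 0 * X 2 + C e * X 1 * X 2 + C h * X 2 ^ 2 := by
  obtain ⟨q, hq, rfl⟩ := exists_sum_mul_X (n := 1) hg
  choose v hv using fun i => IsLinearForm.exists_eq_linForm (hq i)
  refine ⟨v 0 0, v 0 1 + v 1 0, v 1 1, v 0 2 + v 2 0, v 1 2 + v 2 1, v 2 2, ?_⟩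
  simp only [hv, linForm, Fin.sum_univ_three, C_add]
  ring

/-- The ternary cubic form with the given coefficients, grouped by powers of the third variable. -/
noncomputable def cubicForm (a l₁ l₂ q₀ q₁ q₂ g₀ g₁ g₂ g₃ : ℂ) : Ternary :=
  C a * X 2 ^ 3 + (C l₁ * X 0 + C l₂ * X 1) * X 2 ^ 2 +
    (C q₀ * X 0 ^ 2 + C q₁ * X 0 * X 1 + C q₂ * X 1 ^ 2) * X 2 +
    (C g₀ * X 0 ^ 3 + C g₁ * X 0 ^ 2 * X 1 + C g₂ * X 0 * X 1 ^ 2 + C g₃ * X 1 ^ 3)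

theorem exists_eq_cubicForm {g : Ternary} (hg : g.IsHomogeneous 3) :
    ∃ a l₁ l₂ q₀ q₁ q₂ g₀ g₁ g₂ g₃, g = cubicForm a l₁ l₂ q₀ q₁ q₂ g₀ g₁ g₂ g₃ := by
  obtain ⟨q, hq, rfl⟩ := exists_sum_mul_X (n := 2) hg
  choose a b c d e h hv using fun i => exists_quadratic_coeffs (hq i)
  refine ⟨h 2, d 2 + h 0, e 2 + h 1, a 2 + d 0, b 2 + e 0 + d 1, c 2 + e 1,
    a 0, b 0 + a 1, c 0 + b 1, c 1, ?_⟩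
  simp only [hv, cubicForm, Fin.sum_univ_three, C_add]
  ring

theorem eval_hess_cubicForm (a l₁ l₂ q₀ q₁ q₂ g₀ g₁ g₂ g₃ x y z : ℂ) :
    eval ![x, y, z] (hess (cubicForm a l₁ l₂ q₀ q₁ q₂ g₀ g₁ g₂ g₃)) =
      hessVal a l₁ l₂ q₀ q₁ q₂ g₀ g₁ g₂ g₃ x y z := by
  have hofNat (i : Fin 3) (n : ℕ) [n.AtLeastTwo] : pderiv i (OfNat.ofNat n : Ternary) = 0 := by
    rw [← map_ofNat C, pderiv_C]
  rw [hess, hessVal, RingHom.map_det]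
  congr 1
  ext i j
  fin_cases i <;> fin_cases j <;>
    simp [cubicForm, pderiv_X, Pi.single_apply, hofNat] <;> ring

/-- The linear substitution `X i ↦ ∑ j, M i j * X j`. -/
noncomputable def linSubst (M : Matrix (Fin 3) (Fin 3) ℂ) : Ternary →ₐ[ℂ] Ternary :=
  aeval fun i => linForm (M i)

@[simp]
theorem linSubst_X (M : Matrix (Fin 3) (Fin 3) ℂ) (i : Fin 3) :
    linSubst M (X i) = linForm (M i) :=
  aeval_X _ _

@[simp]
theorem linSubst_C (M : Matrix (Fin 3) (Fin 3) ℂ) (r : ℂ) : linSubst M (C r) = C r :=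
  aeval_C _ _

theorem isHomogeneous_linSubst {g : Ternary} {n : ℕ} (hg : g.IsHomogeneous n)
    (M : Matrix (Fin 3) (Fin 3) ℂ) : (linSubst M g).IsHomogeneous n :=
  one_mul n ▸ hg.aeval (fun i => linForm (M i)) (fun i => isLinearForm_linForm (M i))

theorem linSubst_linForm (M : Matrix (Fin 3) (Fin 3) ℂ) (v : Fin 3 → ℂ) :
    linSubst M (linForm v) = linForm (Matrix.vecMul v M) := by
  simp only [linForm, map_add, map_mul, linSubst_C, linSubst_X, Matrix.vecMul, dotProduct,
    Fin.sum_univ_three]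
  ring

theorem linSubst_linSubst (M N : Matrix (Fin 3) (Fin 3) ℂ) (g : Ternary) :
    linSubst M (linSubst N g) = linSubst (N * M) g := by
  rw [← AlgHom.comp_apply]
  refine DFunLike.congr_fun (algHom_ext fun i => ?_) g
  rw [AlgHom.comp_apply, linSubst_X, linSubst_linForm, linSubst_X, Matrix.mul_apply_eq_vecMul]

theorem linSubst_one : linSubst 1 = AlgHom.id ℂ Ternary :=
  algHom_ext fun i => by simp [linForm, Matrix.one_apply]

theorem pderiv_linSubst (M : Matrix (Fin 3) (Fin 3) ℂ) (g : Ternary) (i : Fin 3) :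
    pderiv i (linSubst M g) = ∑ j, C (M j i) * linSubst M (pderiv j g) := by
  induction g using MvPolynomial.induction_on with
  | C r => simp
  | add p q hp hq => simp [hp, hq, mul_add, Finset.sum_add_distrib]
  | mul_X p n hp =>
    have hX : pderiv i (linForm (M n)) = C (M n i) := by
      simp [linForm, pderiv_X, Pi.single_apply]
    simp only [map_mul, Derivation.leibniz, linSubst_X, hp, hX, smul_eq_mul, map_add, mul_add,
      Finset.sum_add_distrib, pderiv_X, Pi.single_apply]
    simp [Finset.mul_sum, mul_comm, mul_left_comm]

theorem hess_linSubst (M : Matrix (Fin 3) (Fin 3) ℂ) (g : Ternary) :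
    hess (linSubst M g) = C (M.det ^ 2) * linSubst M (hess g) := by
  have h : (Matrix.of fun i j => pderiv i (pderiv j (linSubst M g))) =
      (C.mapMatrix M).transpose * (linSubst M).mapMatrix
        (Matrix.of fun i j => pderiv i (pderiv j g)) * C.mapMatrix M := by
    ext1 i j
    simp only [Matrix.of_apply, pderiv_linSubst, map_add, pderiv_mul, pderiv_C, Matrix.mul_apply,
      Matrix.transpose_apply, RingHom.mapMatrix_apply, AlgHom.mapMatrix_apply, Matrix.map_apply,
      Fin.sum_univ_three]
    ring
  rw [hess, h, Matrix.det_mul, Matrix.det_mul, Matrix.det_transpose, ← RingHom.map_det,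
    ← AlgHom.map_det, ← hess, C_pow]
  ring

theorem hess_cuspidal (r s t u : ℂ) :
    hess (cubicForm 0 0 0 r 0 0 s t 0 u) = C (-24 * r ^ 2 * u) * X 0 ^ 2 * X 1 := by
  refine MvPolynomial.funext fun v => ?_
  obtain ⟨x, y, z, rfl⟩ : ∃ x y z, v = ![x, y, z] :=
    ⟨v 0, v 1, v 2, by ext i; fin_cases i <;> rfl⟩
  rw [eval_hess_cubicForm, hessVal_eq]
  simp
  ring

theorem linForm_eq_linearCombination (v : Fin 3 → ℂ) :
    linForm v = Fintype.linearCombination ℂ (X : Fin 3 → Ternary) v := by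
  simp [linForm, Fintype.linearCombination_apply, smul_eq_C_mul]

theorem linearIndependent_linForm_iff {n : ℕ} {v : Fin n → Fin 3 → ℂ} :
    LinearIndependent ℂ (fun i => linForm (v i)) ↔ LinearIndependent ℂ v := by
  simp only [linForm_eq_linearCombination]
  exact LinearMap.linearIndependent_iff _
    (Fintype.linearIndependent_iff'.1 (linearIndependent_X (Fin 3) ℂ))

theorem linearIndependent_linForm_iff_det_ne_zero {M : Matrix (Fin 3) (Fin 3) ℂ} :
    LinearIndependent ℂ (fun i => linForm (M i)) ↔ M.det ≠ 0 := by
  rw [← isUnit_iff_ne_zero, ← Matrix.isUnit_iff_isUnit_det]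
  exact linearIndependent_linForm_iff.trans Matrix.linearIndependent_rows_iff_isUnit

theorem exists_matrix_of_linearIndependent {a b c : Ternary} (ha : IsLinearForm a)
    (hb : IsLinearForm b) (hc : IsLinearForm c) (h : LinearIndependent ℂ ![a, b, c]) :
    ∃ M : Matrix (Fin 3) (Fin 3) ℂ, M.det ≠ 0 ∧
      a = linForm (M 0) ∧ b = linForm (M 1) ∧ c = linForm (M 2) := by
  obtain ⟨u, rfl⟩ := ha.exists_eq_linForm
  obtain ⟨v, rfl⟩ := hb.exists_eq_linForm
  obtain ⟨w, rfl⟩ := hc.exists_eq_linForm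
  refine ⟨![u, v, w], linearIndependent_linForm_iff_det_ne_zero.1 ?_, rfl, rfl, rfl⟩
  convert! h using 1
  ext1 i
  fin_cases i <;> rfl

theorem exists_linearIndependent_cons_cons {a b : Ternary} (ha : IsLinearForm a)
    (hb : IsLinearForm b) (h : LinearIndependent ℂ ![a, b]) :
    ∃ c, IsLinearForm c ∧ LinearIndependent ℂ ![a, b, c] := by
  obtain ⟨u, rfl⟩ := ha.exists_eq_linForm
  obtain ⟨v, rfl⟩ := hb.exists_eq_linForm
  have huv : LinearIndependent ℂ ![u, v] := by
    rw [← linearIndependent_linForm_iff]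
    convert! h using 1
    ext1 i
    fin_cases i <;> rfl
  obtain ⟨w, hw⟩ := exists_linearIndependent_snoc_of_lt_finrank huv (by simp)
  refine ⟨linForm w, isLinearForm_linForm w, ?_⟩
  rw [← linearIndependent_linForm_iff] at hw
  convert! hw using 1
  ext1 i
  fin_cases i <;> rfl

theorem exists_cusp_of_hess {f : Ternary} (hf : f.IsHomogeneous 3) {a b : Ternary}
    (ha : IsLinearForm a) (hb : IsLinearForm b) (hab : LinearIndependent ℂ ![a, b])
    (h : hess f = a ^ 2 * b) :
    ∃ a b c : Ternary, IsLinearForm a ∧ IsLinearForm b ∧ IsLinearForm c ∧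
      LinearIndependent ℂ ![a, b, c] ∧ f = a ^ 2 * c + b ^ 3 := by
  obtain ⟨c, hc, habc⟩ := exists_linearIndependent_cons_cons ha hb hab
  obtain ⟨M, hM, rfl, rfl, rfl⟩ := exists_matrix_of_linearIndependent ha hb hc habc
  have hMM : M * M⁻¹ = 1 := M.mul_nonsing_inv hM.isUnit
  have hMM' : M⁻¹ * M = 1 := M.nonsing_inv_mul hM.isUnit
  obtain ⟨α, l₁, l₂, q₀, q₁, q₂, g₀, g₁, g₂, g₃, hg⟩ :=
    exists_eq_cubicForm (isHomogeneous_linSubst hf M⁻¹)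
  have hfg : f = linSubst M (linSubst M⁻¹ f) := by
    rw [linSubst_linSubst, hMM', linSubst_one, AlgHom.id_apply]
  have hk : (M⁻¹).det ^ 2 ≠ 0 := by simpa [Matrix.det_nonsing_inv] using hM
  have hH : hess (linSubst M⁻¹ f) = C ((M⁻¹).det ^ 2) * (X 0 ^ 2 * X 1) := by
    have hX (i : Fin 3) : linSubst M⁻¹ (linForm (M i)) = X i := by
      rw [← linSubst_X, linSubst_linSubst, hMM, linSubst_one, AlgHom.id_apply]
    simp only [hess_linSubst, h, map_mul, map_pow, hX]
  rw [hg] at hH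
  obtain ⟨⟨rfl, rfl, rfl, rfl, rfl, rfl⟩, hq₀, hg₃⟩ := hessVal_eq_sq_mul hk fun x y z => by
    rw [← eval_hess_cubicForm, hH]
    simp
    ring
  obtain ⟨e, he⟩ := IsAlgClosed.exists_pow_nat_eq g₃ three_pos
  have he0 : e ≠ 0 := by rintro rfl; simp [← he] at hg₃
  let N : Matrix (Fin 3) (Fin 3) ℂ := !![1, 0, 0; 0, e, 0; g₀, g₁, q₀]
  have hN : (N * M).det ≠ 0 := by
    rw [Matrix.det_mul]
    refine mul_ne_zero ?_ hM
    simp [N, Matrix.det_fin_three, hq₀, he0]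
  refine ⟨_, _, _, isLinearForm_linForm ((N * M) 0), isLinearForm_linForm ((N * M) 1),
    isLinearForm_linForm ((N * M) 2), ?_, ?_⟩
  · convert! linearIndependent_linForm_iff_det_ne_zero.2 hN using 1
    ext1 i
    fin_cases i <;> rfl
  · simp only [Matrix.mul_apply_eq_vecMul, ← linSubst_linForm]
    rw [hfg, hg, ← map_pow, ← map_pow, ← map_mul, ← map_add]
    congr 1
    simp [cubicForm, linForm, N, Fin.sum_univ_three, ← he]
    ring

theorem cusp_eq_linSubst (M : Matrix (Fin 3) (Fin 3) ℂ) :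
    linForm (M 0) ^ 2 * linForm (M 2) + linForm (M 1) ^ 3 =
      linSubst M (cubicForm 0 0 0 1 0 0 0 0 0 1) := by
  simp [cubicForm]

theorem exists_hess_cusp_eq {a b c : Ternary} (ha : IsLinearForm a) (hb : IsLinearForm b)
    (hc : IsLinearForm c) (habc : LinearIndependent ℂ ![a, b, c]) :
    ∃ a' b' : Ternary, IsLinearForm a' ∧ IsLinearForm b' ∧ LinearIndependent ℂ ![a', b'] ∧
      hess (a ^ 2 * c + b ^ 3) = a' ^ 2 * b' := by
  obtain ⟨M, hM, rfl, rfl, rfl⟩ := exists_matrix_of_linearIndependent ha hb hc habc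
  have hk : -24 * M.det ^ 2 ≠ 0 := by simpa using hM
  refine ⟨_, C (-24 * M.det ^ 2) * linForm (M 1), ha, hb.C_mul _, ?_, ?_⟩
  · have h₂ : LinearIndependent ℂ ![linForm (M 0), linForm (M 1)] := by
      convert! habc.comp ![0, 1] (by decide) using 1
      ext1 i
      fin_cases i <;> rfl
    rw [LinearIndependent.pair_iff] at h₂ ⊢
    intro s t hst
    have := h₂ s (t * (-24 * M.det ^ 2)) (by rw [← hst, ← smul_eq_C_mul, smul_smul])
    simpa [hM] using this
  · rw [cusp_eq_linSubst, hess_linSubst, hess_cuspidal]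
    simp
    ring

/-- The cuspidal cubic `x² z + y³` is not a sum of three cubes of linear forms. -/
theorem cuspidal_ne_sum_cubes (p q r : Fin 3 → ℂ)
    (h : ∀ x y z : ℂ, ∑ i, (p i * x + q i * y + r i * z) ^ 3 = x ^ 2 * z + y ^ 3) : False := by
  let M : Matrix (Fin 3) (Fin 3) ℂ := ![p, q, r]
  have hppr : ∑ i, p i ^ 2 * r i = 1 / 3 := by
    simp only [Fin.sum_univ_three] at h ⊢
    linear_combination (1 / 6) * (h 1 0 1 + h (-1) 0 1 - 2 * h 0 0 1)
  have hprr : ∑ i, p i * r i ^ 2 = 0 := by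
    simp only [Fin.sum_univ_three] at h ⊢
    linear_combination (1 / 6) * (h 1 0 1 - h (-1) 0 1 - 2 * h 1 0 0)
  by_cases hM : M.det = 0
  · obtain ⟨v, hv, hvM⟩ := Matrix.exists_vecMul_eq_zero_iff.2 hM
    have hi (i : Fin 3) : v 0 * p i + v 1 * q i + v 2 * r i = 0 := by
      simpa [M, Matrix.vecMul, dotProduct, Fin.sum_univ_three] using congrFun hvM i
    simp only [Fin.sum_univ_three] at h hppr hprr
    have h₀ : v 0 = 0 := by
      linear_combination 3 * (hi 0 * p 0 * r 0 + hi 1 * p 1 * r 1 + hi 2 * p 2 * r 2) -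
        3 * v 0 * hppr - 3 * v 2 * hprr - (1 / 2) * v 1 *
          (h 1 1 1 - h 1 1 0 - h 1 0 1 - h 0 1 1 + h 1 0 0 + h 0 1 0 + h 0 0 1)
    have h₁ : v 1 = 0 := by
      linear_combination hi 0 * q 0 ^ 2 + hi 1 * q 1 ^ 2 + hi 2 * q 2 ^ 2 - v 1 * h 0 1 0 -
        (1 / 6) * v 0 * (h 1 1 0 - h (-1) 1 0 - 2 * h 1 0 0) -
        (1 / 6) * v 2 * (h 0 1 1 + h 0 (-1) 1 - 2 * h 0 0 1)
    have h₂ : v 2 = 0 := by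
      linear_combination 3 * (hi 0 * p 0 ^ 2 + hi 1 * p 1 ^ 2 + hi 2 * p 2 ^ 2) -
        3 * v 0 * h 1 0 0 - (1 / 2) * v 1 * (h 1 1 0 + h (-1) 1 0 - 2 * h 0 1 0) - 3 * v 2 * hppr
    exact hv (by ext i; fin_cases i <;> assumption)
  · have hqrr : ∑ i, q i * r i ^ 2 = 0 := by
      simp only [Fin.sum_univ_three] at h ⊢
      linear_combination (1 / 6) * (h 0 1 1 - h 0 (-1) 1 - 2 * h 0 1 0)
    have hrrr : ∑ i, r i * r i ^ 2 = 0 := by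
      simp only [Fin.sum_univ_three] at h ⊢
      linear_combination h 0 0 1
    have hr : M.mulVec (fun i => r i ^ 2) = 0 := by
      ext i
      fin_cases i
      exacts [hprr, hqrr, hrrr]
    have hr' (i : Fin 3) : r i = 0 := by
      simpa using congrFun (Matrix.eq_zero_of_mulVec_eq_zero hM hr) i
    simp [hr'] at hppr

theorem cusp_ne_sum_cubes {a b c : Ternary} (ha : IsLinearForm a) (hb : IsLinearForm b)
    (hc : IsLinearForm c) (habc : LinearIndependent ℂ ![a, b, c]) {l : Fin 3 → Ternary}
    (hl : ∀ i, IsLinearForm (l i)) : a ^ 2 * c + b ^ 3 ≠ ∑ i, l i ^ 3 := by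
  obtain ⟨M, hM, rfl, rfl, rfl⟩ := exists_matrix_of_linearIndependent ha hb hc habc
  intro h
  choose v hv using fun i => IsLinearForm.exists_eq_linForm (isHomogeneous_linSubst (hl i) M⁻¹)
  replace h := congrArg (linSubst M⁻¹) h
  rw [cusp_eq_linSubst, linSubst_linSubst, M.mul_nonsing_inv hM.isUnit, linSubst_one,
    AlgHom.id_apply, map_sum] at h
  simp only [map_pow, hv] at h
  refine cuspidal_ne_sum_cubes (v · 0) (v · 1) (v · 2) fun x y z => ?_
  have := congrArg (eval ![x, y, z]) h
  simp [cubicForm, linForm, Fin.sum_univ_three] at this ⊢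
  exact this.symm

theorem exists_sum_four_cubes {a b c : Ternary} (ha : IsLinearForm a) (hb : IsLinearForm b)
    (hc : IsLinearForm c) :
    ∃ l : Fin 4 → Ternary, (∀ i, IsLinearForm (l i)) ∧ a ^ 2 * c + b ^ 3 = ∑ i, l i ^ 3 := by
  obtain ⟨s, hs⟩ := IsAlgClosed.exists_pow_nat_eq (1 / 6 : ℂ) three_pos
  obtain ⟨t, ht⟩ := IsAlgClosed.exists_pow_nat_eq (-1 / 3 : ℂ) three_pos
  refine ⟨![C s * (c + a), C s * (c - a), C t * c, b], fun i => ?_, ?_⟩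
  · fin_cases i
    exacts [(hc.add ha).C_mul s, (hc.sub ha).C_mul s, hc.C_mul t, hb]
  · have h₁ : (C (1 / 6) * 6 : Ternary) = 1 := by
      rw [← map_ofNat C 6, ← C_mul]
      norm_num
    have h₂ : (C (-1 / 3) : Ternary) = -2 * C (1 / 6) := by
      rw [← map_ofNat C 2, ← C_neg, ← C_mul]
      norm_num
    simp only [Fin.sum_univ_four, Matrix.cons_val, mul_pow, ← C_pow, hs, ht, h₂]
    linear_combination -a ^ 2 * c * h₁

theorem waringRank_cusp {a b c : Ternary} (ha : IsLinearForm a) (hb : IsLinearForm b)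
    (hc : IsLinearForm c) (habc : LinearIndependent ℂ ![a, b, c]) :
    waringRank 3 (a ^ 2 * c + b ^ 3) = 4 := by
  have hmem := exists_sum_four_cubes ha hb hc
  refine le_antisymm (Nat.sInf_le hmem) (le_csInf ⟨4, hmem⟩ ?_)
  rintro r ⟨l, hl, h⟩
  by_contra! hr
  obtain ⟨m, hm⟩ := Nat.exists_eq_add_of_le (Nat.le_of_lt_succ hr)
  have hpad : ∃ l' : Fin (r + m) → Ternary,
      (∀ i, IsLinearForm (l' i)) ∧ ∑ i, l i ^ 3 = ∑ i, l' i ^ 3 := by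
    refine ⟨Fin.append l 0, fun i => ?_, by simp [Fin.sum_univ_add]⟩
    refine Fin.addCases (fun i => ?_) (fun i => ?_) i
    · simpa using hl i
    · simpa [IsLinearForm] using isHomogeneous_zero (Fin 3) ℂ 1
  rw [← hm] at hpad
  obtain ⟨l', hl', hsum⟩ := hpad
  exact cusp_ne_sum_cubes ha hb hc habc hl' (h.trans hsum)

/-- Cusp forms: `Hess f = a² b` iff `f = a² c + b³`, in which case `rank f = 4`. -/
theorem cusp_form_iff (f : Ternary) (hf : MvPolynomial.IsHomogeneous f 3) :
    ((∃ a b : Ternary, IsLinearForm a ∧ IsLinearForm b ∧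
        LinearIndependent ℂ ![a, b] ∧ hess f = a ^ 2 * b) ↔
      (∃ a b c : Ternary, IsLinearForm a ∧ IsLinearForm b ∧ IsLinearForm c ∧
        LinearIndependent ℂ ![a, b, c] ∧ f = a ^ 2 * c + b ^ 3)) ∧
    ((∃ a b c : Ternary, IsLinearForm a ∧ IsLinearForm b ∧ IsLinearForm c ∧
        LinearIndependent ℂ ![a, b, c] ∧ f = a ^ 2 * c + b ^ 3) →
      waringRank 3 f = 4) := by
  refine ⟨⟨?_, ?_⟩, ?_⟩
  · rintro ⟨a, b, ha, hb, hab, h⟩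
    exact exists_cusp_of_hess hf ha hb hab h
  · rintro ⟨a, b, c, ha, hb, hc, habc, rfl⟩
    exact exists_hess_cusp_eq ha hb hc habc
  · rintro ⟨a, b, c, ha, hb, hc, habc, rfl⟩
    exact waringRank_cusp ha hb hc habc
end

section
/- If f = a³ + b³ + c³ + d³ for linear forms a, b, c, d over ℂ that are triplewise linearly independent (every three of the four forms are linearly independent), then the Waring rank of the ternary cubic form f equals 4. -/
open MvPolynomial

/-- If the common kernel of three linear functionals on `ℂ³` is trivial, they take arbitrary
prescribed values simultaneously. -/
lemma exists_apply_eq_of_common_ker_trivial {a b c : (Fin 3 → ℂ) →ₗ[ℂ] ℂ}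
    (h : ∀ p, a p = 0 → b p = 0 → c p = 0 → p = 0) (x y z : ℂ) :
    ∃ p, a p = x ∧ b p = y ∧ c p = z := by
  let T : (Fin 3 → ℂ) →ₗ[ℂ] (Fin 3 → ℂ) := LinearMap.pi ![a, b, c]
  have hT : Function.Injective T := by
    rw [injective_iff_map_eq_zero]
    intro p hp
    exact h p (congrFun hp 0) (congrFun hp 1) (congrFun hp 2)
  obtain ⟨p, hp⟩ := LinearMap.injective_iff_surjective.mp hT ![x, y, z]
  exact ⟨p, congrFun hp 0, congrFun hp 1, congrFun hp 2⟩

/-- Polarization of an identity between sums of cubes of linear functionals. -/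
lemma polarize_sum_cubes {V : Type*} [AddCommGroup V] [Module ℂ V] {a b c d l m n : V →ₗ[ℂ] ℂ}
    (h : ∀ p, a p ^ 3 + b p ^ 3 + c p ^ 3 + d p ^ 3 = l p ^ 3 + m p ^ 3 + n p ^ 3) (p q r : V) :
    a p * a q * a r + b p * b q * b r + c p * c q * c r + d p * d q * d r =
      l p * l q * l r + m p * m q * m r + n p * n q * n r := by
  have h1 := h (p + q + r)
  have h2 := h (p + q)
  have h3 := h (p + r)
  have h4 := h (q + r)
  simp only [map_add] at h1 h2 h3 h4
  linear_combination (h1 - h2 - h3 - h4 + h p + h q + h r) / 6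

/-- Two independent vectors cannot both lie in the kernels of `a` and `b` if `a`, `b`, `d` have
trivial common kernel. -/
lemma false_of_two_functionals_vanish {V : Type*} [AddCommGroup V] [Module ℂ V]
    {a b d m n : V →ₗ[ℂ] ℂ} {v w : V}
    (h : ∀ p, a p = 0 → b p = 0 → d p = 0 → p = 0)
    (hav : a v = 0) (haw : a w = 0) (hbv : b v = 0) (hbw : b w = 0)
    (hmv : m v = 1) (hnv : n v = 0) (hnw : n w = 1) : False := by
  have hp := h (d w • v - d v • w) (by simp [hav, haw]) (by simp [hbv, hbw])
    (by simp [mul_comm])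
  have hn := congrArg n hp
  have hv : v = 0 := h v hav hbv (by simpa [hnv, hnw] using hn)
  simp [hv] at hmv

/-- Let `a`, `b`, `c`, `d` be triplewise independent. If the products `u * v` and `u * w` satisfy
the equations expressing that they are apolar to the cubic `a³ + b³ + c³ + d³`, then `d` does not
vanish at `u`. -/
lemma apply_ne_zero_of_apolar {V : Type*} [AddCommGroup V] [Module ℂ V]
    {a b c d l m n : V →ₗ[ℂ] ℂ} {u v w : V} {α β γ : ℂ}
    (habc : ∀ p, a p = 0 → b p = 0 → c p = 0 → p = 0)
    (habd : ∀ p, a p = 0 → b p = 0 → d p = 0 → p = 0)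
    (hacd : ∀ p, a p = 0 → c p = 0 → d p = 0 → p = 0)
    (hbcd : ∀ p, b p = 0 → c p = 0 → d p = 0 → p = 0)
    (hlu : l u = 1) (hmv : m v = 1) (hnv : n v = 0) (hnw : n w = 1)
    (ha : ∀ q, q = v ∨ q = w → a u * a q + α * (d u * d q) = 0)
    (hb : ∀ q, q = v ∨ q = w → b u * b q + β * (d u * d q) = 0)
    (hc : ∀ q, q = v ∨ q = w → c u * c q + γ * (d u * d q) = 0) : d u ≠ 0 := by
  intro hd
  have hu : u ≠ 0 := by rintro rfl; simp at hlu
  simp only [hd, zero_mul, mul_zero, add_zero, mul_eq_zero] at ha hb hc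
  have kill (f : V →ₗ[ℂ] ℂ) (hf : ∀ q, q = v ∨ q = w → f u = 0 ∨ f q = 0) (hfu : f u ≠ 0) :
      f v = 0 ∧ f w = 0 :=
    ⟨(hf v (.inl rfl)).resolve_left hfu, (hf w (.inr rfl)).resolve_left hfu⟩
  by_cases hau : a u = 0
  · have hB := kill b hb fun hbu => hu (habd u hau hbu hd)
    have hC := kill c hc fun hcu => hu (hacd u hau hcu hd)
    exact false_of_two_functionals_vanish hbcd hB.1 hB.2 hC.1 hC.2 hmv hnv hnw
  · have hA := kill a ha hau
    by_cases hbu : b u = 0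
    · have hC := kill c hc fun hcu => hu (hbcd u hbu hcu hd)
      exact false_of_two_functionals_vanish hacd hA.1 hA.2 hC.1 hC.2 hmv hnv hnw
    · have hB := kill b hb hbu
      exact false_of_two_functionals_vanish habc hA.1 hA.2 hB.1 hB.2 hmv hnv hnw

/-- A sum of four cubes of triplewise independent functionals on `ℂ³` is not a sum of three
cubes. -/
lemma sum_four_cubes_ne_sum_three_cubes {a b c d l m n : (Fin 3 → ℂ) →ₗ[ℂ] ℂ}
    (habc : ∀ p, a p = 0 → b p = 0 → c p = 0 → p = 0)
    (habd : ∀ p, a p = 0 → b p = 0 → d p = 0 → p = 0)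
    (hacd : ∀ p, a p = 0 → c p = 0 → d p = 0 → p = 0)
    (hbcd : ∀ p, b p = 0 → c p = 0 → d p = 0 → p = 0)
    (h : ∀ p, a p ^ 3 + b p ^ 3 + c p ^ 3 + d p ^ 3 = l p ^ 3 + m p ^ 3 + n p ^ 3) : False := by
  have F := polarize_sum_cubes h
  obtain ⟨e₁, ha₁, hb₁, hc₁⟩ := exists_apply_eq_of_common_ker_trivial habc 1 0 0
  obtain ⟨e₂, ha₂, hb₂, hc₂⟩ := exists_apply_eq_of_common_ker_trivial habc 0 1 0
  obtain ⟨e₃, ha₃, hb₃, hc₃⟩ := exists_apply_eq_of_common_ker_trivial habc 0 0 1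
  have hd₁ : d e₁ ≠ 0 := fun hd => by simp [hbcd e₁ hb₁ hc₁ hd] at ha₁
  have hd₂ : d e₂ ≠ 0 := fun hd => by simp [hacd e₂ ha₂ hc₂ hd] at hb₂
  have hlmn : ∀ p, l p = 0 → m p = 0 → n p = 0 → p = 0 := by
    intro p hl hm hn
    have hd : d p = 0 := by
      simpa [hl, hm, hn, ha₁, hb₁, hc₁, ha₂, hb₂, hc₂, hd₁, hd₂] using F p e₁ e₂
    have ha : a p = 0 := by simpa [hl, hm, hn, ha₁, hb₁, hc₁, hd] using F p e₁ e₁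
    have hb : b p = 0 := by simpa [hl, hm, hn, ha₂, hb₂, hc₂, hd] using F p e₂ e₂
    exact habd p ha hb hd
  obtain ⟨u, hlu, hmu, hnu⟩ := exists_apply_eq_of_common_ker_trivial hlmn 1 0 0
  obtain ⟨v, hlv, hmv, hnv⟩ := exists_apply_eq_of_common_ker_trivial hlmn 0 1 0
  obtain ⟨w, hlw, hmw, hnw⟩ := exists_apply_eq_of_common_ker_trivial hlmn 0 0 1
  have apolar (p q : Fin 3 → ℂ) (hl : l p * l q = 0) (hm : m p * m q = 0) (hn : n p * n q = 0) :
      a p * a q + d e₁ * (d p * d q) = 0 ∧ b p * b q + d e₂ * (d p * d q) = 0 ∧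
        c p * c q + d e₃ * (d p * d q) = 0 := by
    have h₁ := F p q e₁
    have h₂ := F p q e₂
    have h₃ := F p q e₃
    simp only [ha₁, hb₁, hc₁, ha₂, hb₂, hc₂, ha₃, hb₃, hc₃, hl, hm, hn] at h₁ h₂ h₃
    exact ⟨by linear_combination h₁, by linear_combination h₂, by linear_combination h₃⟩
  have huv := apolar u v (by simp [hlu, hlv]) (by simp [hmu, hmv]) (by simp [hnu, hnv])
  have huw := apolar u w (by simp [hlu, hlw]) (by simp [hmu, hmw]) (by simp [hnu, hnw])
  have hvu := apolar v u (by simp [hlv, hlu]) (by simp [hmv, hmu]) (by simp [hnv, hnu])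
  have hvw := apolar v w (by simp [hlv, hlw]) (by simp [hmv, hmw]) (by simp [hnv, hnw])
  have hwu := apolar w u (by simp [hlw, hlu]) (by simp [hmw, hmu]) (by simp [hnw, hnu])
  have hwv := apolar w v (by simp [hlw, hlv]) (by simp [hmw, hmv]) (by simp [hnw, hnv])
  have hdu : d u ≠ 0 := apply_ne_zero_of_apolar habc habd hacd hbcd hlu hmv hnv hnw
    (by rintro q (rfl | rfl); exacts [huv.1, huw.1])
    (by rintro q (rfl | rfl); exacts [huv.2.1, huw.2.1])
    (by rintro q (rfl | rfl); exacts [huv.2.2, huw.2.2])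
  have hdv : d v ≠ 0 := apply_ne_zero_of_apolar habc habd hacd hbcd hmv hlu hnu hnw
    (by rintro q (rfl | rfl); exacts [hvu.1, hvw.1])
    (by rintro q (rfl | rfl); exacts [hvu.2.1, hvw.2.1])
    (by rintro q (rfl | rfl); exacts [hvu.2.2, hvw.2.2])
  have hdw : d w ≠ 0 := apply_ne_zero_of_apolar habc habd hacd hbcd hnw hlu hmu hmv
    (by rintro q (rfl | rfl); exacts [hwu.1, hwv.1])
    (by rintro q (rfl | rfl); exacts [hwu.2.1, hwv.2.1])
    (by rintro q (rfl | rfl); exacts [hwu.2.2, hwv.2.2])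
  have hau : a u ≠ 0 := fun h0 => by simpa [h0, hd₁, hdu, hdv] using huv.1
  have hav : a v ≠ 0 := fun h0 => by simpa [h0, hd₁, hdu, hdv] using huv.1
  have haw : a w ≠ 0 := fun h0 => by simpa [h0, hd₁, hdu, hdw] using huw.1
  have hp : a (d v • u - d u • v) = 0 := by
    simp only [map_sub, map_smul, smul_eq_mul]
    refine (mul_eq_zero.mp ?_).resolve_left (mul_ne_zero haw hdw)
    linear_combination (d v * d w) * huw.1 - (d u * d w) * hvw.1
  have hq : a (d w • u - d u • w) = 0 := by
    simp only [map_sub, map_smul, smul_eq_mul]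
    refine (mul_eq_zero.mp ?_).resolve_left (mul_ne_zero hav hdv)
    linear_combination (d w * d v) * huv.1 - (d u * d v) * hwv.1
  obtain ⟨e, hae, hbe, hde⟩ := exists_apply_eq_of_common_ker_trivial habd 1 0 0
  have he : e - (l e • u + m e • v + n e • w) = 0 := hlmn _ (by simp [hlu, hlv, hlw])
    (by simp [hmu, hmv, hmw]) (by simp [hnu, hnv, hnw])
  have hae' := congrArg a he
  have hde' := congrArg d he
  simp only [map_sub, map_add, map_smul, smul_eq_mul, map_zero, hae, hde] at hp hq hae' hde'
  refine hdu ?_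
  linear_combination d u * hae' - a u * hde' - m e * hp - n e * hq

/-- Evaluation of a linear form, as a linear functional of the point. -/
noncomputable def linearFormFunctional (a : Ternary) : (Fin 3 → ℂ) →ₗ[ℂ] ℂ :=
  ∑ i, coeff (Finsupp.single i 1) a • LinearMap.proj i

lemma linearFormFunctional_apply (a : Ternary) (p : Fin 3 → ℂ) :
    linearFormFunctional a p = ∑ i, coeff (Finsupp.single i 1) a * p i := by
  simp [linearFormFunctional]

lemma IsLinearForm.eq_sum_C_mul_X {a : Ternary} (ha : IsLinearForm a) :
    a = ∑ i, C (coeff (Finsupp.single i 1) a) * X i := by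
  ext s
  rw [coeff_sum]
  by_cases hs : ∃ i, s = Finsupp.single i 1
  · obtain ⟨i, rfl⟩ := hs
    simp [coeff_C_mul, coeff_X, Finsupp.single_left_inj]
  · have hX : ∀ i : Fin 3, coeff s (X i : Ternary) = 0 := fun i => by
      rw [coeff_X, if_neg fun h => hs ⟨i, h.symm⟩]
    simp only [coeff_C_mul, hX, mul_zero, Finset.sum_const_zero]
    refine ha.coeff_eq_zero fun hdeg => hs ?_
    obtain ⟨i, rfl⟩ := Finsupp.range_single_one.ge hdeg
    exact ⟨i, rfl⟩

lemma IsLinearForm.eval_eq {a : Ternary} (ha : IsLinearForm a) (p : Fin 3 → ℂ) :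
    eval p a = linearFormFunctional a p := by
  conv_lhs => rw [ha.eq_sum_C_mul_X]
  simp [linearFormFunctional_apply]

/-- Three linearly independent ternary linear forms have no common nontrivial zero. -/
lemma common_ker_trivial_of_linearIndependent {a b c : Ternary}
    (ha : IsLinearForm a) (hb : IsLinearForm b) (hc : IsLinearForm c)
    (h : LinearIndependent ℂ ![a, b, c]) (p : Fin 3 → ℂ) (hap : linearFormFunctional a p = 0)
    (hbp : linearFormFunctional b p = 0) (hcp : linearFormFunctional c p = 0) : p = 0 := by
  let M : Matrix (Fin 3) (Fin 3) ℂ :=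
    Matrix.of fun i j => coeff (Finsupp.single j 1) (![a, b, c] i)
  have hform : ∀ i, IsLinearForm (![a, b, c] i) := by
    intro i
    fin_cases i
    exacts [ha, hb, hc]
  have hM : LinearIndependent ℂ M.row := by
    rw [Fintype.linearIndependent_iff] at h ⊢
    intro g hg
    refine h g ?_
    have hlin : IsLinearForm (∑ i, g i • ![a, b, c] i) :=
      (homogeneousSubmodule (Fin 3) ℂ 1).sum_mem fun i _ =>
        (homogeneousSubmodule (Fin 3) ℂ 1).smul_mem _ (hform i)
    rw [hlin.eq_sum_C_mul_X]
    refine Finset.sum_eq_zero fun j _ => ?_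
    have hj := congrFun hg j
    simp only [Finset.sum_apply, Pi.smul_apply, Pi.zero_apply] at hj
    rw [coeff_sum]
    simp only [coeff_smul]
    change ∑ i, g i • coeff (Finsupp.single j 1) (![a, b, c] i) = 0 at hj
    rw [hj, C_0, zero_mul]
  have hinj := Matrix.mulVec_injective_iff_isUnit.mpr
    (Matrix.linearIndependent_rows_iff_isUnit.mp hM)
  refine hinj (funext fun i => ?_)
  rw [Matrix.mulVec_zero]
  have hi : (M.mulVec p) i = linearFormFunctional (![a, b, c] i) p := by
    rw [linearFormFunctional_apply]; rfl
  rw [hi]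
  fin_cases i
  exacts [hap, hbp, hcp]

/-- A sum of four cubes of triplewise independent linear forms has Waring rank 4. -/
theorem rank_sum_four_cubes (a b c d : Ternary)
    (ha : IsLinearForm a) (hb : IsLinearForm b) (hc : IsLinearForm c) (hd : IsLinearForm d)
    (habc : LinearIndependent ℂ ![a, b, c]) (habd : LinearIndependent ℂ ![a, b, d])
    (hacd : LinearIndependent ℂ ![a, c, d]) (hbcd : LinearIndependent ℂ ![b, c, d]) :
    waringRank 3 (a ^ 3 + b ^ 3 + c ^ 3 + d ^ 3) = 4 := by
  have hmem : 4 ∈ {r : ℕ | ∃ l : Fin r → Ternary, (∀ i, IsLinearForm (l i)) ∧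
      a ^ 3 + b ^ 3 + c ^ 3 + d ^ 3 = ∑ i, (l i) ^ 3} := by
    refine ⟨![a, b, c, d], fun i => ?_, by simp [Fin.sum_univ_four]⟩
    fin_cases i
    exacts [ha, hb, hc, hd]
  refine le_antisymm (Nat.sInf_le hmem) (le_csInf ⟨4, hmem⟩ ?_)
  rintro r ⟨l, hl, h⟩
  by_contra! hr
  have key : ∀ x y z : Ternary, IsLinearForm x → IsLinearForm y → IsLinearForm z →
      a ^ 3 + b ^ 3 + c ^ 3 + d ^ 3 ≠ x ^ 3 + y ^ 3 + z ^ 3 := by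
    intro x y z hx hy hz hxyz
    refine sum_four_cubes_ne_sum_three_cubes
      (common_ker_trivial_of_linearIndependent ha hb hc habc)
      (common_ker_trivial_of_linearIndependent ha hb hd habd)
      (common_ker_trivial_of_linearIndependent ha hc hd hacd)
      (common_ker_trivial_of_linearIndependent hb hc hd hbcd)
      (l := linearFormFunctional x) (m := linearFormFunctional y)
      (n := linearFormFunctional z) fun p => ?_
    simpa only [map_add, map_pow, ha.eval_eq, hb.eval_eq, hc.eval_eq, hd.eval_eq, hx.eval_eq,
      hy.eval_eq, hz.eval_eq] using congrArg (eval p) hxyz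
  have h0 : IsLinearForm 0 := isHomogeneous_zero _ _ _
  interval_cases r
  · exact key 0 0 0 h0 h0 h0 (by simpa using h)
  · exact key (l 0) 0 0 (hl 0) h0 h0 (by simpa using h)
  · exact key (l 0) (l 1) 0 (hl 0) (hl 1) h0 (by simpa [Fin.sum_univ_two] using h)
  · exact key (l 0) (l 1) (l 2) (hl 0) (hl 1) (hl 2) (by simpa [Fin.sum_univ_three] using h)
end
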